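/- Let n ≥ 1 and let u, v be probability densities on ℝⁿ such that (T_s u dx, T_t v dx) ∈ Π_𝒮 for all s, t ≥ 0. Then for every τ > 0, W₂²(T_τ u dx, T_τ v dx) ≤ W₂²(u dx, v dx) − 4n ∫₀^τ sinh²( (H(T_t u dx|dx) − H(T_t v dx|dx)) / (2n) ) dt. -/

import Mathlib

open MeasureTheory Filter Set
open scoped ENNReal NNReal

noncomputable section

abbrev Eucl (n : ℕ) : Type := EuclideanSpace ℝ (Fin n)

/-- Heat semigroup `T_t` on `ℝⁿ` (generator `Δ/2`), with `T_0 f = f`. -/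
noncomputable def heat (n : ℕ) (t : ℝ) (f : Eucl n → ℝ) (x : Eucl n) : ℝ :=
  if t = 0 then f x
  else ∫ y : Eucl n, f y * Real.exp (-‖x - y‖ ^ 2 / (2 * t)) / (2 * Real.pi * t) ^ ((n : ℝ) / 2)

/-- Relative entropy `H(ρ dx | dx) = ∫ ρ log ρ dx` of a density `ρ`. -/
noncomputable def entDens (n : ℕ) (ρ : Eucl n → ℝ) : ℝ :=
  ∫ x : Eucl n, ρ x * Real.log (ρ x)

/-- The measure `ρ dx`. -/
noncomputable def densMeas (n : ℕ) (ρ : Eucl n → ℝ) : Measure (Eucl n) :=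
  (volume : Measure (Eucl n)).withDensity fun x => ENNReal.ofReal (ρ x)

/-- The measure `R₀₁(dx dy) = e^{-|x-y|²/2} (2π)^{-n/2} dx dy` on `ℝⁿ × ℝⁿ`. -/
noncomputable def R01 (n : ℕ) : Measure (Eucl n × Eucl n) :=
  (volume : Measure (Eucl n × Eucl n)).withDensity fun p =>
    ENNReal.ofReal (Real.exp (-‖p.1 - p.2‖ ^ 2 / 2) / (2 * Real.pi) ^ ((n : ℝ) / 2))

open Classical in
/-- Relative entropy `H(p|r) = ∫ log (dp/dr) dp`, `+∞` if not absolutely continuous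
(or not integrable; the paper's definition requires an integrability condition as well). -/
noncomputable def relEnt {X : Type} [MeasurableSpace X] (p r : Measure X) : EReal :=
  if p ≪ r ∧ Integrable (fun x => Real.log (p.rnDeriv r x).toReal) p
  then ((∫ x, Real.log (p.rnDeriv r x).toReal ∂p : ℝ) : EReal) else ⊤

/-- `π` is a coupling of `μ0` and `μ1`. -/
def Coupling {X : Type} [MeasurableSpace X] (π : Measure (X × X)) (μ0 μ1 : Measure X) : Prop :=
  IsProbabilityMeasure π ∧ π.map Prod.fst = μ0 ∧ π.map Prod.snd = μ1

/-- Relative entropy of a measure with respect to Lebesgue, `∫ ρ log ρ` for the density `ρ`. -/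
noncomputable def entLeb (n : ℕ) (μ : Measure (Eucl n)) : ℝ :=
  ∫ x, (μ.rnDeriv volume x).toReal * Real.log ((μ.rnDeriv volume x).toReal)

/-- Entropic cost (EReal-valued):
`𝒜(μ0,μ1) = inf { H(π|R₀₁) } - (H(μ0|dx)+H(μ1|dx))/2`. -/
noncomputable def entCostE (n : ℕ) (μ0 μ1 : Measure (Eucl n)) : EReal :=
  (⨅ π : {π : Measure (Eucl n × Eucl n) // Coupling π μ0 μ1}, relEnt (π.1) (R01 n))
    - (((entLeb n μ0 + entLeb n μ1) / 2 : ℝ) : EReal)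

/-- Entropic cost, real-valued. -/
noncomputable def entCost (n : ℕ) (μ0 μ1 : Measure (Eucl n)) : ℝ :=
  (entCostE n μ0 μ1).toReal

/-- Squared quadratic Wasserstein distance. -/
noncomputable def W2sq (n : ℕ) (μ0 μ1 : Measure (Eucl n)) : ℝ :=
  (⨅ π : {π : Measure (Eucl n × Eucl n) // Coupling π μ0 μ1},
      ∫⁻ p, (‖p.1 - p.2‖₊ : ℝ≥0∞) ^ 2 ∂(π.1)).toReal

/-- `f` is (the function of) a Schwartz function. -/
def IsSchwartz (n : ℕ) (f : Eucl n → ℝ) : Prop :=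
  ∃ F : SchwartzMap (Eucl n) ℝ, ⇑F = f

/-- The pair `(μ0, μ1)` belongs to `Π_𝒮`: it admits a Schrödinger decomposition
`μ0 = f·T₁g dx`, `μ1 = g·T₁f dx` with `f, g` positive Schwartz functions bounded below
by a Gaussian. -/
def PiS (n : ℕ) (μ0 μ1 : Measure (Eucl n)) : Prop :=
  ∃ f g : Eucl n → ℝ, IsSchwartz n f ∧ IsSchwartz n g ∧
    (∀ x, 0 < f x) ∧ (∀ x, 0 < g x) ∧
    (∃ α c : ℝ, 0 < α ∧ 0 < c ∧ (∀ x, c * Real.exp (-α * ‖x‖ ^ 2) ≤ f x) ∧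
      (∀ x, c * Real.exp (-α * ‖x‖ ^ 2) ≤ g x)) ∧
    μ0 = densMeas n (fun x => f x * heat n 1 g x) ∧
    μ1 = densMeas n (fun x => g x * heat n 1 f x)

/-- Laplacian `Δφ = ∑ᵢ ∂²φ/∂xᵢ²`. -/
noncomputable def lap (n : ℕ) (φ : Eucl n → ℝ) (x : Eucl n) : ℝ :=
  ∑ i, fderiv ℝ (fun y => fderiv ℝ φ y (EuclideanSpace.single i 1)) x (EuclideanSpace.single i 1)

/-- Squared Hilbert-Schmidt norm of the Hessian, `‖Hess φ‖² = ∑ᵢⱼ (∂ᵢ∂ⱼφ)²`. -/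
noncomputable def hessHS (n : ℕ) (φ : Eucl n → ℝ) (x : Eucl n) : ℝ :=
  ∑ i, ∑ j, (fderiv ℝ (fun y => fderiv ℝ φ y (EuclideanSpace.single j 1)) x
    (EuclideanSpace.single i 1)) ^ 2

/-- Divergence `∇·F = ∑ᵢ ∂Fᵢ/∂xᵢ` of a vector field. -/
noncomputable def diverg (n : ℕ) (F : Eucl n → Eucl n) (x : Eucl n) : ℝ :=
  ∑ i, fderiv ℝ (fun y => F y i) x (EuclideanSpace.single i 1)

/-- Heat semigroup acting componentwise on vector-valued functions. -/
noncomputable def heatV (n : ℕ) (t : ℝ) (F : Eucl n → Eucl n) (x : Eucl n) : Eucl n :=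
  (EuclideanSpace.equiv (Fin n) ℝ).symm (fun i => heat n t (fun y => F y i) x)

/-- Entropic interpolation density `μ_s = T_s f · T_{1-s} g`. -/
noncomputable def entInterp (n : ℕ) (f g : Eucl n → ℝ) (s : ℝ) (x : Eucl n) : ℝ :=
  heat n s f x * heat n (1 - s) g x

/-- The potential `θ_s = (log T_{1-s} g - log T_s f)/2`, whose gradient drives the
transport equation of the entropic interpolation. -/
noncomputable def thetaPot (n : ℕ) (f g : Eucl n → ℝ) (s : ℝ) (x : Eucl n) : ℝ :=
  (Real.log (heat n (1 - s) g x) - Real.log (heat n s f x)) / 2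

end

noncomputable section
namespace HeatContraction
open ProbabilityTheory
open scoped RealInnerProductSpace Topology

section

variable {n : ℕ}

/-- The Gaussian kernel of variance `r` on `ℝⁿ`. -/
def gaussKer (n : ℕ) (r : ℝ) (x : Eucl n) : ℝ :=
  Real.exp (-‖x‖ ^ 2 / (2 * r)) / (2 * Real.pi * r) ^ ((n : ℝ) / 2)

lemma gaussKer_pos {r : ℝ} (hr : 0 < r) (x : Eucl n) : 0 < gaussKer n r x := by
  unfold gaussKer; positivity

lemma gaussKer_le {r : ℝ} (hr : 0 < r) (x : Eucl n) :
    gaussKer n r x ≤ 1 / (2 * Real.pi * r) ^ ((n : ℝ) / 2) := by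
  unfold gaussKer
  gcongr
  rw [Real.exp_le_one_iff]
  have : 0 ≤ ‖x‖ ^ 2 / (2 * r) := by positivity
  rw [neg_div]; linarith

lemma continuous_gaussKer (r : ℝ) : Continuous (gaussKer n r) := by
  unfold gaussKer; fun_prop

lemma integral_cexp_gaussKer {r : ℝ} (hr : 0 < r) (t : Eucl n) :
    ∫ x : Eucl n, gaussKer n r x • Complex.exp (⟪x, t⟫ * Complex.I)
      = Complex.exp (-(r * ‖t‖ ^ 2) / 2) := by
  have h := GaussianFourier.integral_cexp_neg_mul_sq_norm_add (V := Eucl n)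
    (b := ((1 / (2 * r) : ℝ) : ℂ)) (by rw [Complex.ofReal_re]; positivity) Complex.I t
  have hpos : (0 : ℝ) < 2 * Real.pi * r := by positivity
  have h2 : ∀ x : Eucl n, gaussKer n r x • Complex.exp (⟪x, t⟫ * Complex.I)
      = (((2 * Real.pi * r) ^ ((n : ℝ) / 2) : ℝ) : ℂ)⁻¹ *
        Complex.exp (-((1 / (2 * r) : ℝ) : ℂ) * ‖x‖ ^ 2 + Complex.I * ⟪t, x⟫) := by
    intro x
    rw [Complex.exp_add, gaussKer, Complex.real_smul, Complex.ofReal_div, Complex.ofReal_exp,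
      real_inner_comm, mul_comm (Complex.I), div_eq_inv_mul, mul_assoc]
    congr 3
    push_cast
    field_simp
  simp_rw [h2]
  rw [integral_const_mul, h, ← mul_assoc]
  have h3 : (((2 * Real.pi * r) ^ ((n : ℝ) / 2) : ℝ) : ℂ)⁻¹ *
      ((Real.pi : ℂ) / ((1 / (2 * r) : ℝ) : ℂ)) ^ ((Module.finrank ℝ (Eucl n) : ℂ) / 2) = 1 := by
    have : ((Real.pi : ℂ) / ((1 / (2 * r) : ℝ) : ℂ)) = ((2 * Real.pi * r : ℝ) : ℂ) := by
      push_cast; field_simp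
    rw [this]
    have h4 : ((Module.finrank ℝ (Eucl n) : ℂ) / 2) = (((n : ℝ) / 2 : ℝ) : ℂ) := by
      simp
    rw [h4, ← Complex.ofReal_cpow hpos.le]
    apply inv_mul_cancel₀
    exact_mod_cast (Real.rpow_pos_of_pos hpos _).ne'
  rw [h3, one_mul, Complex.I_sq]
  congr 1
  have : (r : ℂ) ≠ 0 := by exact_mod_cast hr.ne'
  push_cast
  field_simp
  norm_num

lemma integral_gaussKer {r : ℝ} (hr : 0 < r) : ∫ x : Eucl n, gaussKer n r x = 1 := by
  have h := integral_cexp_gaussKer (n := n) hr 0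
  simp only [inner_zero_right, Complex.ofReal_zero, zero_mul, Complex.exp_zero, norm_zero,
    Complex.real_smul, mul_one] at h
  rw [integral_complex_ofReal] at h
  have h' : ((∫ x : Eucl n, gaussKer n r x : ℝ) : ℂ) = 1 := by simpa using h
  exact_mod_cast h'

lemma integrable_gaussKer {r : ℝ} (hr : 0 < r) : Integrable (gaussKer n r) := by
  by_contra h
  have := integral_gaussKer (n := n) hr
  rw [integral_undef h] at this
  exact zero_ne_one this

lemma isProbabilityMeasure_gaussKer {r : ℝ} (hr : 0 < r) :
    IsProbabilityMeasure (densMeas n (gaussKer n r)) := by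
  constructor
  rw [densMeas, withDensity_apply _ MeasurableSet.univ, Measure.restrict_univ,
    ← ofReal_integral_eq_lintegral_ofReal (integrable_gaussKer hr)
      (ae_of_all _ fun x => (gaussKer_pos hr x).le), integral_gaussKer hr, ENNReal.ofReal_one]

/-- The centred Gaussian of variance `r` has density `gaussKer n r`. -/
lemma map_sqrt_smul_stdGaussian {r : ℝ} (hr : 0 < r) :
    (stdGaussian (Eucl n)).map (fun z => √r • z) = densMeas n (gaussKer n r) := by
  have := isProbabilityMeasure_gaussKer (n := n) hr
  have : IsProbabilityMeasure ((stdGaussian (Eucl n)).map (fun z => √r • z)) :=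
    Measure.isProbabilityMeasure_map (by fun_prop)
  apply Measure.ext_of_charFun
  ext t
  rw [charFun_map_smul, charFun_stdGaussian, charFun_apply, densMeas,
    integral_withDensity_eq_integral_toReal_smul
      ((continuous_gaussKer r).measurable.ennreal_ofReal) (ae_of_all _ fun _ => by simp)]
  simp_rw [ENNReal.toReal_ofReal (gaussKer_pos hr _).le]
  rw [integral_cexp_gaussKer hr, norm_smul]
  congr 1
  rw [Real.norm_of_nonneg (Real.sqrt_nonneg _)]
  have : ((√r : ℝ) : ℂ) ^ 2 = r := by exact_mod_cast Real.sq_sqrt hr.le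
  push_cast
  rw [mul_pow, this]

/-- The standard Gaussian measure on `ℝⁿ`. -/
abbrev gam (n : ℕ) : Measure (Eucl n) := stdGaussian (Eucl n)

lemma memLp_gam : MemLp (fun z : Eucl n => z) 2 (gam n) :=
  IsGaussian.memLp_id _ 2 (by simp)

lemma integral_gam : ∫ z, z ∂(gam n) = 0 := integral_id_stdGaussian

lemma integrable_gam : Integrable (fun z : Eucl n => z) (gam n) :=
  memLp_gam.integrable (by norm_num)

lemma integrable_normSq_gam : Integrable (fun z : Eucl n => ‖z‖ ^ 2) (gam n) :=
  memLp_gam.integrable_norm_pow (by norm_num)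

lemma integral_normSq_gam : ∫ z, ‖z‖ ^ 2 ∂(gam n) = n := by
  have h1 : ∀ i : Fin n, ∫ z : Eucl n, (z i) ^ 2 ∂(gam n) = 1 := by
    intro i
    have h := covarianceBilin_apply (μ := gam n) (memLp_gam)
      (EuclideanSpace.single i 1) (EuclideanSpace.single i 1)
    rw [covarianceBilin_stdGaussian] at h
    have h0 : ∫ z, z ∂(gam n) = 0 := integral_gam
    simp only [h0, id, sub_zero, EuclideanSpace.inner_single_left, map_one, one_mul] at h
    simp only [sq]
    rw [← h, show (innerSL ℝ) (EuclideanSpace.single i (1 : ℝ)) (EuclideanSpace.single i 1)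
      = ⟪EuclideanSpace.single i (1 : ℝ), EuclideanSpace.single i 1⟫ from rfl]
    simp
  have h2 : ∀ i : Fin n, Integrable (fun z : Eucl n => (z i) ^ 2) (gam n) := by
    intro i
    refine integrable_normSq_gam.mono' (by fun_prop) (ae_of_all _ fun z => ?_)
    rw [EuclideanSpace.norm_sq_eq]
    simp only [Real.norm_eq_abs, sq_abs, abs_pow]
    exact Finset.single_le_sum (f := fun i => (z i) ^ 2) (fun j _ => sq_nonneg _)
      (Finset.mem_univ i)
  simp_rw [EuclideanSpace.norm_sq_eq, Real.norm_eq_abs, sq_abs]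
  rw [integral_finsetSum _ fun i _ => h2 i]
  simp [h1]

lemma map_rotation_gam (θ : ℝ) :
    ((gam n).prod (gam n)).map (ContinuousLinearMap.rotation θ)
      = (gam n).prod (gam n) := by
  apply IsGaussian.map_rotation_eq_self_of_forall_strongDual_eq_zero
  intro L
  exact integral_strongDual_stdGaussian L

end

section

variable {n : ℕ}

/-- The point at time `s` of the segment joining the two coordinates of `p`. -/
def line (s : ℝ) (p : Eucl n × Eucl n) : Eucl n := p.1 + s • (p.2 - p.1)

/-- The initial velocity and an independent standard Gaussian vector. -/
abbrev PG (π : Measure (Eucl n × Eucl n)) : Measure ((Eucl n × Eucl n) × Eucl n) :=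
  π.prod (gam n)

/-- The interpolating random point, smoothed by a Gaussian of variance `r`. -/
def pt (s r : ℝ) (ω : (Eucl n × Eucl n) × Eucl n) : Eucl n := line s ω.1 + √r • ω.2

/-- The velocity of the interpolating point when the variance grows at rate `c`. -/
def vel (r c : ℝ) (ω : (Eucl n × Eucl n) × Eucl n) : Eucl n :=
  (ω.1.2 - ω.1.1) + (c / (2 * √r)) • ω.2

/-- The density of the interpolating point. -/
def dens (π : Measure (Eucl n × Eucl n)) (s r : ℝ) (x : Eucl n) : ℝ :=
  ∫ p, gaussKer n r (x - line s p) ∂π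

/-- The numerator of the score. -/
def scoreNum (π : Measure (Eucl n × Eucl n)) (s r : ℝ) (x : Eucl n) : Eucl n :=
  ∫ p, gaussKer n r (x - line s p) • (x - line s p) ∂π

/-- Minus the logarithmic gradient of the density of the interpolating point. -/
def score (π : Measure (Eucl n × Eucl n)) (s r : ℝ) (x : Eucl n) : Eucl n :=
  (r * dens π s r x)⁻¹ • scoreNum π s r x

lemma continuous_line_right (s : ℝ) : Continuous (line (n := n) s) := by
  unfold line; fun_prop

lemma continuous_pt (s r : ℝ) : Continuous (pt (n := n) s r) := by
  unfold pt line; fun_prop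

lemma continuous_vel (r c : ℝ) : Continuous (vel (n := n) r c) := by
  unfold vel; fun_prop

lemma norm_line_le (s : ℝ) (p : Eucl n × Eucl n) :
    ‖line s p‖ ≤ ‖p.1‖ + |s| * ‖p.2 - p.1‖ := by
  unfold line
  refine (norm_add_le _ _).trans ?_
  rw [norm_smul, Real.norm_eq_abs]

lemma continuousAt_gaussKer {r : ℝ} (hr : 0 < r) (x : Eucl n) :
    ContinuousAt (fun q : ℝ × Eucl n => gaussKer n q.1 q.2) (r, x) := by
  have hne : (2 * r) ≠ 0 := by positivity
  have hp : 0 < 2 * Real.pi * r := by positivity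
  unfold gaussKer
  refine ContinuousAt.div ?_ ?_ ?_
  · refine Real.continuous_exp.continuousAt.comp ?_
    exact ContinuousAt.div (by fun_prop) (by fun_prop) hne
  · exact ContinuousAt.rpow_const (by fun_prop) (Or.inl hp.ne')
  · exact (Real.rpow_pos_of_pos hp _).ne'

/-- Both marginals have finite second moments. -/
def SecondMoments (π : Measure (Eucl n × Eucl n)) : Prop :=
  MemLp (fun p : Eucl n × Eucl n => p.1) 2 π ∧ MemLp (fun p : Eucl n × Eucl n => p.2) 2 π

variable {π : Measure (Eucl n × Eucl n)}

lemma SecondMoments.memLp_sub (hm : SecondMoments π) :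
    MemLp (fun p : Eucl n × Eucl n => p.2 - p.1) 2 π := hm.2.sub hm.1

lemma SecondMoments.memLp_line (hm : SecondMoments π) (s : ℝ) :
    MemLp (line (n := n) s) 2 π := hm.1.add (hm.memLp_sub.const_smul s)

variable [IsProbabilityMeasure π]

lemma SecondMoments.memLp_const_sub_line (hm : SecondMoments π) (s : ℝ) (x : Eucl n) :
    MemLp (fun p => x - line s p) 2 π := (memLp_const x).sub (hm.memLp_line s)

lemma SecondMoments.integrable_norm_const_sub (hm : SecondMoments π) (s : ℝ) (x : Eucl n) :
    Integrable (fun p => ‖x - line s p‖) π :=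
  ((hm.memLp_const_sub_line s x).integrable (by norm_num)).norm

/-- A uniform bound for the Gaussian kernel near a given positive variance. -/
lemma gaussKer_le_of_half {r₀ r : ℝ} (h₀ : 0 < r₀) (hr : r₀ / 2 ≤ r) (x : Eucl n) :
    gaussKer n r x ≤ 1 / (Real.pi * r₀) ^ ((n : ℝ) / 2) := by
  refine (gaussKer_le (by linarith) x).trans ?_
  have : Real.pi * r₀ ≤ 2 * Real.pi * r := by nlinarith [Real.pi_pos]
  gcongr

lemma continuousAt_dens {s r : ℝ} (hr : 0 < r) (x : Eucl n) :
    ContinuousAt (fun q : ℝ × ℝ × Eucl n => dens π q.1 q.2.1 q.2.2) (s, r, x) := by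
  unfold dens
  have hev : ∀ᶠ q : ℝ × ℝ × Eucl n in 𝓝 (s, r, x), r / 2 < q.2.1 :=
    (continuous_snd.fst.tendsto (s, r, x)).eventually (lt_mem_nhds (by simp; linarith))
  refine continuousAt_of_dominated (bound := fun _ => 1 / (Real.pi * r) ^ ((n : ℝ) / 2))
    (.of_forall fun q => ?_) ?_ (integrable_const _) (ae_of_all _ fun p => ?_)
  · exact ((continuous_gaussKer _).comp
      (continuous_const.sub (continuous_line_right _))).aestronglyMeasurable
  · filter_upwards [hev] with q hq
    refine ae_of_all _ fun p => ?_
    rw [Real.norm_of_nonneg (gaussKer_pos (by linarith) _).le]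
    exact gaussKer_le_of_half hr hq.le _
  · have hc : Continuous fun q : ℝ × ℝ × Eucl n => (q.2.1, q.2.2 - line q.1 p) := by
      unfold line; fun_prop
    exact ContinuousAt.comp (f := fun q : ℝ × ℝ × Eucl n => (q.2.1, q.2.2 - line q.1 p))
      (continuousAt_gaussKer hr (x - line s p)) (x := (s, r, x)) hc.continuousAt

lemma continuousAt_scoreNum (hm : SecondMoments π) {s r : ℝ} (hr : 0 < r) (x : Eucl n) :
    ContinuousAt (fun q : ℝ × ℝ × Eucl n => scoreNum π q.1 q.2.1 q.2.2) (s, r, x) := by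
  unfold scoreNum
  have hev : ∀ᶠ q : ℝ × ℝ × Eucl n in 𝓝 (s, r, x), r / 2 < q.2.1 :=
    (continuous_snd.fst.tendsto (s, r, x)).eventually (lt_mem_nhds (by simp; linarith))
  have hev2 : ∀ᶠ q : ℝ × ℝ × Eucl n in 𝓝 (s, r, x), ‖q.2.2‖ < ‖x‖ + 1 :=
    (continuous_snd.snd.norm.tendsto (s, r, x)).eventually (gt_mem_nhds (by simp))
  have hev3 : ∀ᶠ q : ℝ × ℝ × Eucl n in 𝓝 (s, r, x), |q.1| < |s| + 1 :=
    (continuous_fst.abs.tendsto (s, r, x)).eventually (gt_mem_nhds (by simp))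
  refine continuousAt_of_dominated (bound := fun p => 1 / (Real.pi * r) ^ ((n : ℝ) / 2) *
      (‖x‖ + 1 + (‖p.1‖ + (|s| + 1) * ‖p.2 - p.1‖)))
    (.of_forall fun q => ?_) ?_ ?_ (ae_of_all _ fun p => ?_)
  · have h1 := continuous_const (y := q.2.2).sub (continuous_line_right (n := n) q.1)
    exact (((continuous_gaussKer _).comp h1).smul h1).aestronglyMeasurable
  · filter_upwards [hev, hev2, hev3] with q hq hq2 hq3
    refine ae_of_all _ fun p => ?_
    rw [norm_smul, Real.norm_of_nonneg (gaussKer_pos (by linarith) _).le]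
    gcongr
    · exact gaussKer_le_of_half hr hq.le _
    · refine (norm_sub_le _ _).trans (add_le_add hq2.le ((norm_line_le _ _).trans ?_))
      gcongr
  · refine Integrable.const_mul ?_ _
    refine (integrable_const _).add ((hm.1.integrable (by norm_num)).norm.add ?_)
    exact ((hm.memLp_sub.integrable (by norm_num)).norm.const_mul _)
  · have hc : Continuous fun q : ℝ × ℝ × Eucl n => (q.2.1, q.2.2 - line q.1 p) := by
      unfold line; fun_prop
    have h2 := ContinuousAt.comp (f := fun q : ℝ × ℝ × Eucl n => (q.2.1, q.2.2 - line q.1 p))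
      (continuousAt_gaussKer hr (x - line s p)) (x := (s, r, x)) hc.continuousAt
    exact ContinuousAt.smul h2 hc.snd.continuousAt

lemma integrable_gaussKer_sub_line {r : ℝ} (hr : 0 < r) (s : ℝ) (x : Eucl n) :
    Integrable (fun p => gaussKer n r (x - line s p)) π := by
  refine (integrable_const (1 / (2 * Real.pi * r) ^ ((n : ℝ) / 2))).mono'
    ((continuous_gaussKer _).comp
      (continuous_const.sub (continuous_line_right _))).aestronglyMeasurable
    (ae_of_all _ fun p => ?_)
  rw [Real.norm_of_nonneg (gaussKer_pos hr _).le]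
  exact gaussKer_le hr _

lemma dens_pos {r : ℝ} (hr : 0 < r) (s : ℝ) (x : Eucl n) : 0 < dens π s r x := by
  unfold dens
  rw [integral_pos_iff_support_of_nonneg (fun p => (gaussKer_pos hr _).le)
    (integrable_gaussKer_sub_line hr s x)]
  have : Function.support (fun p => gaussKer n r (x - line s p)) = univ := by
    ext p; simp [(gaussKer_pos hr (x - line s p)).ne']
  rw [this]; simp

lemma dens_le {r : ℝ} (hr : 0 < r) (s : ℝ) (x : Eucl n) :
    dens π s r x ≤ 1 / (2 * Real.pi * r) ^ ((n : ℝ) / 2) := by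
  have := integral_mono (integrable_gaussKer_sub_line (π := π) hr s x) (integrable_const _)
    (fun p => gaussKer_le hr (x - line s p))
  simpa [dens] using this

lemma continuousAt_score (hm : SecondMoments π) {s r : ℝ} (hr : 0 < r) (x : Eucl n) :
    ContinuousAt (fun q : ℝ × ℝ × Eucl n => score π q.1 q.2.1 q.2.2) (s, r, x) := by
  unfold score
  refine ContinuousAt.smul (ContinuousAt.inv₀ (ContinuousAt.mul (by fun_prop)
    (continuousAt_dens hr x)) ?_) (continuousAt_scoreNum hm hr x)
  exact (mul_pos hr (dens_pos hr s x)).ne'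

lemma continuous_dens {r : ℝ} (hr : 0 < r) (s : ℝ) : Continuous (dens π s r) :=
  continuous_iff_continuousAt.2 fun x =>
    ContinuousAt.comp (f := fun y : Eucl n => (s, r, y)) (continuousAt_dens hr x) (by fun_prop)

lemma continuous_score (hm : SecondMoments π) {r : ℝ} (hr : 0 < r) (s : ℝ) :
    Continuous (score π s r) :=
  continuous_iff_continuousAt.2 fun x =>
    ContinuousAt.comp (f := fun y : Eucl n => (s, r, y)) (continuousAt_score hm hr x) (by fun_prop)

lemma exp_neg_sq_div_mul_sub_le {r D y m : ℝ} (hr : 0 < r) (hD : 0 < D) (hy : 0 ≤ y)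
    (hm : 0 ≤ m) :
    Real.exp (-y ^ 2 / (2 * r)) / D * (y - m) ≤ Real.exp (-m ^ 2 / (2 * r)) / D * (y - m) := by
  rcases le_total y m with h | h
  · refine mul_le_mul_of_nonpos_right ?_ (by linarith)
    gcongr
  · refine mul_le_mul_of_nonneg_right ?_ (by linarith)
    gcongr

/-- Association inequality: the weight is a decreasing function of the distance. -/
lemma integral_gaussKer_mul_norm_le (hm : SecondMoments π) {r : ℝ} (hr : 0 < r) (s : ℝ)
    (x : Eucl n) :
    ∫ p, gaussKer n r (x - line s p) * ‖x - line s p‖ ∂π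
      ≤ dens π s r x * ∫ p, ‖x - line s p‖ ∂π := by
  set m := ∫ p, ‖x - line s p‖ ∂π with hmdef
  have hm0 : 0 ≤ m := integral_nonneg fun p => norm_nonneg _
  set k := Real.exp (-m ^ 2 / (2 * r)) / (2 * Real.pi * r) ^ ((n : ℝ) / 2) with hk
  have hi1 := hm.integrable_norm_const_sub s x
  have hi2 : Integrable (fun p => gaussKer n r (x - line s p) * ‖x - line s p‖) π := by
    refine hi1.bdd_mul (c := 1 / (2 * Real.pi * r) ^ ((n : ℝ) / 2))
      ((continuous_gaussKer _).comp
        (continuous_const.sub (continuous_line_right _))).aestronglyMeasurable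
      (ae_of_all _ fun p => ?_)
    rw [Real.norm_of_nonneg (gaussKer_pos hr _).le]
    exact gaussKer_le hr _
  have hpt : ∀ p : Eucl n × Eucl n,
      gaussKer n r (x - line s p) * ‖x - line s p‖ - gaussKer n r (x - line s p) * m
        ≤ k * (‖x - line s p‖ - m) := by
    intro p
    rw [← mul_sub]
    exact exp_neg_sq_div_mul_sub_le hr (by positivity) (norm_nonneg _) hm0
  have hint := integral_mono (hi2.sub ((integrable_gaussKer_sub_line hr s x).mul_const m))
    ((hi1.sub (integrable_const m)).const_mul k) hpt
  rw [integral_sub' hi2 ((integrable_gaussKer_sub_line hr s x).mul_const m), integral_mul_const,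
    integral_const_mul, integral_sub' hi1 (integrable_const m)] at hint
  simp only [integral_const, probReal_univ, smul_eq_mul, one_mul] at hint
  rw [← hmdef, sub_self, mul_zero] at hint
  unfold dens
  linarith

lemma norm_score_le (hm : SecondMoments π) {r : ℝ} (hr : 0 < r) (s : ℝ) (x : Eucl n) :
    ‖score π s r x‖ ≤ (‖x‖ + (∫ p, ‖p.1‖ ∂π + |s| * ∫ p, ‖p.2 - p.1‖ ∂π)) / r := by
  have hd := dens_pos (π := π) hr s x
  have h1 : ‖scoreNum π s r x‖ ≤ dens π s r x * ∫ p, ‖x - line s p‖ ∂π := by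
    refine (norm_integral_le_integral_norm _).trans ?_
    simp_rw [norm_smul, Real.norm_of_nonneg (gaussKer_pos hr _).le]
    exact integral_gaussKer_mul_norm_le hm hr s x
  have hi1 : Integrable (fun p : Eucl n × Eucl n => ‖p.1‖) π :=
    (hm.1.integrable (by norm_num)).norm
  have hi2 : Integrable (fun p : Eucl n × Eucl n => ‖p.2 - p.1‖) π :=
    (hm.memLp_sub.integrable (by norm_num)).norm
  have hi3 : Integrable (fun p : Eucl n × Eucl n => |s| * ‖p.2 - p.1‖) π := hi2.const_mul |s|
  have hi4 : Integrable (fun p : Eucl n × Eucl n => ‖p.1‖ + |s| * ‖p.2 - p.1‖) π := hi1.add hi3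
  have h2 : ∫ p, ‖x - line s p‖ ∂π
      ≤ ‖x‖ + (∫ p, ‖p.1‖ ∂π + |s| * ∫ p, ‖p.2 - p.1‖ ∂π) := by
    have := integral_mono (hm.integrable_norm_const_sub s x)
      ((integrable_const ‖x‖).add hi4)
      (fun p => (norm_sub_le _ _).trans (add_le_add le_rfl (norm_line_le s p)))
    simp only [Pi.add_apply] at this
    rwa [integral_add (integrable_const _) hi4, integral_add hi1 hi3, integral_const_mul, integral_const, probReal_univ, one_smul] at this
  rw [score, norm_smul, norm_inv, Real.norm_of_nonneg (mul_pos hr hd).le, mul_inv, mul_assoc,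
    ← div_eq_inv_mul]
  gcongr
  rw [inv_mul_le_iff₀ hd]
  exact h1.trans (by gcongr)

end

section

variable {n : ℕ}

lemma integrable_inner_of_memLp_two {α : Type*} [MeasurableSpace α] {μ : Measure α}
    {f g : α → Eucl n} (hf : MemLp f 2 μ) (hg : MemLp g 2 μ) :
    Integrable (fun x => ⟪f x, g x⟫) μ := by
  refine (hf.norm.integrable_mul hg.norm).mono (hf.1.inner hg.1) (ae_of_all _ fun x => ?_)
  simp only [Pi.mul_apply, norm_mul, norm_norm]
  exact norm_inner_le_norm _ _

lemma integrable_normSq_of_memLp_two {α : Type*} [MeasurableSpace α] {μ : Measure α}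
    {f : α → Eucl n} (hf : MemLp f 2 μ) : Integrable (fun x => ‖f x‖ ^ 2) μ :=
  hf.integrable_norm_pow (by norm_num)

variable {π : Measure (Eucl n × Eucl n)} [IsProbabilityMeasure π]

lemma integrable_scoreNum (hm : SecondMoments π) {r : ℝ} (hr : 0 < r) (s : ℝ) (x : Eucl n) :
    Integrable (fun p => gaussKer n r (x - line s p) • (x - line s p)) π := by
  refine ((hm.memLp_const_sub_line s x).integrable (by norm_num)).bdd_smul
    (1 / (2 * Real.pi * r) ^ ((n : ℝ) / 2))
    (integrable_gaussKer_sub_line hr s x).aestronglyMeasurable (ae_of_all _ fun p => ?_)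
  rw [Real.norm_of_nonneg (gaussKer_pos hr _).le]
  exact gaussKer_le hr _

omit [IsProbabilityMeasure π] in
lemma map_pair_pt {r : ℝ} (hr : 0 < r) (s : ℝ) :
    (PG π).map (fun ω => (ω.1, pt s r ω)) = (π.prod volume).withDensity
      (fun q => ENNReal.ofReal (gaussKer n r (q.2 - line s q.1))) := by
  have hmeas : Measurable fun q : (Eucl n × Eucl n) × Eucl n =>
      ENNReal.ofReal (gaussKer n r (q.2 - line s q.1)) :=
    ((continuous_gaussKer r).comp (continuous_snd.sub
      ((continuous_line_right s).comp continuous_fst))).measurable.ennreal_ofReal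
  refine Measure.ext_of_lintegral _ fun Φ hΦ => ?_
  have hm1 : Measurable fun ω : (Eucl n × Eucl n) × Eucl n => (ω.1, pt s r ω) :=
    measurable_fst.prodMk (continuous_pt s r).measurable
  have hm2 : Measurable fun ω : (Eucl n × Eucl n) × Eucl n => Φ (ω.1, pt s r ω) := hΦ.comp hm1
  rw [lintegral_map hΦ hm1, lintegral_withDensity_eq_lintegral_mul _ hmeas hΦ,
    lintegral_prod _ hm2.aemeasurable, lintegral_prod _ (hmeas.mul hΦ).aemeasurable]
  refine lintegral_congr fun p => ?_
  have hΦp : Measurable fun y => Φ (p, line s p + y) :=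
    hΦ.comp (measurable_const.prodMk (measurable_const.add measurable_id))
  have hsm : Measurable fun z : Eucl n => √r • z := measurable_const_smul _
  have h1 : ∫⁻ z, Φ (p, line s p + √r • z) ∂(gam n)
      = ∫⁻ y, Φ (p, line s p + y) ∂((gam n).map (fun z => √r • z)) :=
    (lintegral_map hΦp hsm).symm
  have h2 := lintegral_add_left_eq_self (μ := (volume : Measure (Eucl n)))
    (fun x => ENNReal.ofReal (gaussKer n r (x - line s p)) * Φ (p, x)) (line s p)
  change ∫⁻ z, Φ (p, line s p + √r • z) ∂(gam n) =
    ∫⁻ x, ENNReal.ofReal (gaussKer n r (x - line s p)) * Φ (p, x)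
  rw [h1, ← h2, map_sqrt_smul_stdGaussian hr, densMeas,
    lintegral_withDensity_eq_lintegral_mul _ (continuous_gaussKer r).measurable.ennreal_ofReal hΦp]
  simp only [Pi.mul_apply, add_sub_cancel_left]

lemma map_pt {r : ℝ} (hr : 0 < r) (s : ℝ) :
    (PG π).map (pt s r) = densMeas n (dens π s r) := by
  have hmeas : Measurable fun q : (Eucl n × Eucl n) × Eucl n =>
      ENNReal.ofReal (gaussKer n r (q.2 - line s q.1)) :=
    ((continuous_gaussKer r).comp (continuous_snd.sub
      ((continuous_line_right s).comp continuous_fst))).measurable.ennreal_ofReal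
  have hm1 : Measurable fun ω : (Eucl n × Eucl n) × Eucl n => (ω.1, pt s r ω) :=
    measurable_fst.prodMk (continuous_pt s r).measurable
  have h0 : (PG π).map (pt s r) = ((PG π).map (fun ω => (ω.1, pt s r ω))).map Prod.snd := by
    exact (Measure.map_map measurable_snd hm1).symm
  rw [h0, map_pair_pt hr]
  refine Measure.ext_of_lintegral _ fun Φ hΦ => ?_
  have hm2 : Measurable fun q : (Eucl n × Eucl n) × Eucl n => Φ q.2 := hΦ.comp measurable_snd
  rw [lintegral_map hΦ measurable_snd, lintegral_withDensity_eq_lintegral_mul _ hmeas hm2,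
    lintegral_prod_symm _ (hmeas.mul hm2).aemeasurable,
    densMeas, lintegral_withDensity_eq_lintegral_mul _
      (continuous_dens hr s).measurable.ennreal_ofReal hΦ]
  refine lintegral_congr fun x => ?_
  have hmx : Measurable fun p : Eucl n × Eucl n =>
      ENNReal.ofReal (gaussKer n r (x - line s p)) :=
    ((continuous_gaussKer r).comp (continuous_const.sub
      (continuous_line_right s))).measurable.ennreal_ofReal
  simp only [Pi.mul_apply]
  have hd : ENNReal.ofReal (dens π s r x)
      = ∫⁻ p, ENNReal.ofReal (gaussKer n r (x - line s p)) ∂π :=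
    ofReal_integral_eq_lintegral_ofReal (integrable_gaussKer_sub_line hr s x)
      (ae_of_all _ fun p => (gaussKer_pos hr _).le)
  rw [hd]
  exact lintegral_mul_const _ hmx

omit [IsProbabilityMeasure π] in
lemma SecondMoments.memLp_fst (hm : SecondMoments π) :
    MemLp (fun ω : (Eucl n × Eucl n) × Eucl n => ω.1.1) 2 (PG π) :=
  hm.1.comp_measurePreserving measurePreserving_fst

omit [IsProbabilityMeasure π] in
lemma SecondMoments.memLp_vel (hm : SecondMoments π) :
    MemLp (fun ω : (Eucl n × Eucl n) × Eucl n => ω.1.2 - ω.1.1) 2 (PG π) :=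
  hm.memLp_sub.comp_measurePreserving measurePreserving_fst

lemma memLp_noise :
    MemLp (fun ω : (Eucl n × Eucl n) × Eucl n => ω.2) 2 (PG π) :=
  memLp_gam.comp_measurePreserving measurePreserving_snd

lemma SecondMoments.memLp_pt (hm : SecondMoments π) (s r : ℝ) : MemLp (pt s r) 2 (PG π) :=
  (hm.memLp_fst.add (hm.memLp_vel.const_smul s)).add (memLp_noise.const_smul (√r))

lemma SecondMoments.memLp_score (hm : SecondMoments π) {r : ℝ} (hr : 0 < r) (s : ℝ) :
    MemLp (fun ω => score π s r (pt s r ω)) 2 (PG π) := by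
  have h : MemLp (fun ω => (‖pt s r ω‖ + (∫ p, ‖p.1‖ ∂π + |s| * ∫ p, ‖p.2 - p.1‖ ∂π)) * r⁻¹)
    2 (PG π) := ((hm.memLp_pt s r).norm.add (memLp_const _)).mul_const _
  refine h.mono' ((continuous_score hm hr s).comp (continuous_pt s r)).aestronglyMeasurable
    (ae_of_all _ fun ω => ?_)
  rw [← div_eq_mul_inv]
  exact norm_score_le hm hr s _

/-- Gaussian integration by parts: the score represents the noise. -/
lemma integral_inner_noise (hm : SecondMoments π) {r : ℝ} (hr : 0 < r) (s : ℝ)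
    {f : Eucl n → Eucl n} (hf : Measurable f) (hf2 : MemLp (fun ω => f (pt s r ω)) 2 (PG π)) :
    ∫ ω, ⟪ω.2, f (pt s r ω)⟫ ∂(PG π) = √r * ∫ ω, ⟪score π s r (pt s r ω), f (pt s r ω)⟫ ∂(PG π) := by
  have hsr : 0 < √r := Real.sqrt_pos.2 hr
  have hlc : Continuous fun q : (Eucl n × Eucl n) × Eucl n => q.2 - line s q.1 :=
    continuous_snd.sub ((continuous_line_right s).comp continuous_fst)
  have hmeas : Measurable fun q : (Eucl n × Eucl n) × Eucl n =>
      ENNReal.ofReal (gaussKer n r (q.2 - line s q.1)) :=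
    ((continuous_gaussKer r).comp hlc).measurable.ennreal_ofReal
  have hm1 : Measurable fun ω : (Eucl n × Eucl n) × Eucl n => (ω.1, pt s r ω) :=
    measurable_fst.prodMk (continuous_pt s r).measurable
  set G : (Eucl n × Eucl n) × Eucl n → ℝ := fun q => (√r)⁻¹ * ⟪q.2 - line s q.1, f q.2⟫ with hG
  have hGm : Measurable G :=
    measurable_const.mul (hlc.measurable.inner (hf.comp measurable_snd))
  have hGω : ∀ ω : (Eucl n × Eucl n) × Eucl n,
      ⟪ω.2, f (pt s r ω)⟫ = G (ω.1, pt s r ω) := by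
    intro ω
    simp only [hG, pt, add_sub_cancel_left, real_inner_smul_left]
    field_simp
  have hGi : Integrable G ((PG π).map fun ω => (ω.1, pt s r ω)) := by
    rw [integrable_map_measure hGm.aestronglyMeasurable hm1.aemeasurable]
    refine (integrable_inner_of_memLp_two memLp_noise hf2).congr (ae_of_all _ fun ω => ?_)
    exact hGω ω
  rw [map_pair_pt hr, integrable_withDensity_iff_integrable_smul' hmeas
    (ae_of_all _ fun _ => by simp)] at hGi
  simp_rw [hGω]
  rw [← integral_map (f := G) hm1.aemeasurable hGm.aestronglyMeasurable, map_pair_pt hr,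
    integral_withDensity_eq_integral_toReal_smul hmeas (ae_of_all _ fun _ => by simp),
    integral_prod_symm _ hGi]
  have hsc : Measurable fun x => ⟪score π s r x, f x⟫ :=
    (continuous_score hm hr s).measurable.inner hf
  rw [← integral_map (φ := pt s r) (f := fun x => ⟪score π s r x, f x⟫)
    (continuous_pt s r).measurable.aemeasurable hsc.aestronglyMeasurable, map_pt hr, densMeas,
    integral_withDensity_eq_integral_toReal_smul
      (continuous_dens hr s).measurable.ennreal_ofReal (ae_of_all _ fun _ => by simp),
    ← integral_const_mul]
  refine integral_congr_ae (ae_of_all _ fun x => ?_)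
  have e1 : ∀ p, (ENNReal.ofReal (gaussKer n r (x - line s p))).toReal • G (p, x)
      = (√r)⁻¹ * ⟪f x, gaussKer n r (x - line s p) • (x - line s p)⟫ := by
    intro p
    rw [ENNReal.toReal_ofReal (gaussKer_pos hr _).le, real_inner_smul_right, hG, real_inner_comm,
      smul_eq_mul]
    ring
  have hd := dens_pos (π := π) hr s x
  simp only [e1]
  rw [integral_const_mul, integral_inner (integrable_scoreNum hm hr s x), ENNReal.toReal_ofReal hd.le, smul_eq_mul]
  change (√r)⁻¹ * ⟪f x, scoreNum π s r x⟫ = _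
  rw [score, real_inner_smul_left, real_inner_comm]
  have : √r * √r = r := Real.mul_self_sqrt hr.le
  have hr' := hr.ne'
  field_simp
  rw [pow_two, this]; field_simp

end

section

variable {n : ℕ}

/-- The correlation of the initial velocity with the score. -/
def slopeV (π : Measure (Eucl n × Eucl n)) (s r : ℝ) : ℝ :=
  ∫ ω, ⟪ω.1.2 - ω.1.1, score π s r (pt s r ω)⟫ ∂(PG π)

/-- The Fisher information of the interpolating point. -/
def fisher (π : Measure (Eucl n × Eucl n)) (s r : ℝ) : ℝ :=
  ∫ ω, ‖score π s r (pt s r ω)‖ ^ 2 ∂(PG π)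

/-- The derivative of the differential entropy along a curve of variances with derivative `c`. -/
def slope (π : Measure (Eucl n × Eucl n)) (s r c : ℝ) : ℝ :=
  slopeV π s r + c / 2 * fisher π s r

/-- The differential entropy of the interpolating point. -/
def ent (π : Measure (Eucl n × Eucl n)) (s r : ℝ) : ℝ :=
  -∫ ω, Real.log (dens π s r (pt s r ω)) ∂(PG π)

/-- The mean square of the initial velocity. -/
def velSq (π : Measure (Eucl n × Eucl n)) : ℝ := ∫ p, ‖p.2 - p.1‖ ^ 2 ∂π

lemma velSq_nonneg (π : Measure (Eucl n × Eucl n)) : 0 ≤ velSq π :=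
  integral_nonneg fun _ => by positivity

lemma fisher_nonneg (π : Measure (Eucl n × Eucl n)) (s r : ℝ) : 0 ≤ fisher π s r :=
  integral_nonneg fun _ => by positivity

variable {π : Measure (Eucl n × Eucl n)} [IsProbabilityMeasure π]

lemma integral_normSq_noise : ∫ ω, ‖ω.2‖ ^ 2 ∂(PG π) = n := by
  have h := integral_fun_snd (μ := π) (ν := gam n) (fun z : Eucl n => ‖z‖ ^ 2)
  simpa [integral_normSq_gam] using h

lemma integral_normSq_vel : ∫ ω : (Eucl n × Eucl n) × Eucl n, ‖ω.1.2 - ω.1.1‖ ^ 2 ∂(PG π)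
    = velSq π := by
  have h := integral_fun_fst (μ := π) (ν := gam n) (fun p => ‖p.2 - p.1‖ ^ 2)
  simpa [velSq] using h

lemma integral_inner_noise_score (hm : SecondMoments π) {r : ℝ} (hr : 0 < r) (s : ℝ) :
    ∫ ω, ⟪ω.2, score π s r (pt s r ω)⟫ ∂(PG π) = √r * fisher π s r := by
  rw [integral_inner_noise hm hr s (continuous_score hm hr s).measurable (hm.memLp_score hr s)]
  simp [fisher]

lemma fisher_le (hm : SecondMoments π) {r : ℝ} (hr : 0 < r) (s : ℝ) : fisher π s r ≤ n / r := by
  have h1 := integrable_normSq_of_memLp_two (memLp_noise (π := π))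
  have h2 := integrable_normSq_of_memLp_two (hm.memLp_score hr s)
  have h3 := integrable_inner_of_memLp_two (memLp_noise (π := π)) (hm.memLp_score hr s)
  have h := integral_mono (h3.const_mul (2 * √r)) (h1.add (h2.const_mul r)) (fun ω => by
    have h4 : 0 ≤ ‖ω.2 - √r • score π s r (pt s r ω)‖ ^ 2 := by positivity
    rw [norm_sub_sq_real, norm_smul, mul_pow, real_inner_smul_right, Real.norm_eq_abs, sq_abs,
      Real.sq_sqrt hr.le] at h4
    simp only [Pi.add_apply]
    linarith)
  rw [integral_const_mul, integral_add' h1 (h2.const_mul r), integral_const_mul,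
    integral_inner_noise_score hm hr, integral_normSq_noise] at h
  change _ ≤ n + r * fisher π s r at h
  rw [le_div_iff₀ hr]
  nlinarith [Real.mul_self_sqrt hr.le]

lemma integral_inner_vel_score (hm : SecondMoments π) {r : ℝ} (hr : 0 < r) (s c : ℝ) :
    ∫ ω, ⟪vel r c ω, score π s r (pt s r ω)⟫ ∂(PG π) = slope π s r c := by
  have h1 := integrable_inner_of_memLp_two hm.memLp_vel (hm.memLp_score hr s)
  have h3 := integrable_inner_of_memLp_two (memLp_noise (π := π)) (hm.memLp_score hr s)
  simp only [vel, inner_add_left, real_inner_smul_left]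
  rw [integral_add h1 (h3.const_mul _), integral_const_mul, integral_inner_noise_score hm hr,
    slope, slopeV]
  have := Real.sqrt_pos.2 hr
  field_simp

lemma abs_slopeV_le (hm : SecondMoments π) {r : ℝ} (hr : 0 < r) (s : ℝ) :
    |slopeV π s r| ≤ (velSq π + n / r) / 2 := by
  have h1 := integrable_normSq_of_memLp_two hm.memLp_vel
  have h2 := integrable_normSq_of_memLp_two (hm.memLp_score hr s)
  have h := norm_integral_le_of_norm_le ((h1.add h2).div_const 2)
    (f := fun ω => ⟪ω.1.2 - ω.1.1, score π s r (pt s r ω)⟫) (ae_of_all _ fun ω => by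
    refine (norm_inner_le_norm _ _).trans ?_
    simp only [Pi.add_apply]
    nlinarith [sq_nonneg (‖ω.1.2 - ω.1.1‖ - ‖score π s r (pt s r ω)‖)])
  rw [integral_div, integral_add' h1 h2, integral_normSq_vel] at h
  refine h.trans ?_
  have := fisher_le hm hr s
  unfold fisher at this
  gcongr

lemma abs_slope_le (hm : SecondMoments π) {r : ℝ} (hr : 0 < r) (s c : ℝ) :
    |slope π s r c| ≤ (velSq π + n / r) / 2 + |c| / 2 * (n / r) := by
  unfold slope
  refine (abs_add_le _ _).trans (add_le_add (abs_slopeV_le hm hr s) ?_)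
  rw [abs_mul, abs_div, abs_two, abs_of_nonneg (fisher_nonneg π s r)]
  have := fisher_le hm hr s
  gcongr

lemma norm_pt_le (s r : ℝ) (ω : (Eucl n × Eucl n) × Eucl n) :
    ‖pt s r ω‖ ≤ ‖ω.1.1‖ + |s| * ‖ω.1.2 - ω.1.1‖ + √r * ‖ω.2‖ := by
  unfold pt
  refine (norm_add_le _ _).trans (add_le_add (norm_line_le _ _) ?_)
  rw [norm_smul, Real.norm_of_nonneg (Real.sqrt_nonneg r)]

lemma continuousAt_score_pt (hm : SecondMoments π) {r : ℝ} (hr : 0 < r) (s : ℝ)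
    (ω : (Eucl n × Eucl n) × Eucl n) :
    ContinuousAt (fun q : ℝ × ℝ => score π q.1 q.2 (pt q.1 q.2 ω)) (s, r) := by
  have hc : Continuous fun q : ℝ × ℝ => (q.1, q.2, pt q.1 q.2 ω) := by
    unfold pt line; fun_prop
  exact ContinuousAt.comp (f := fun q : ℝ × ℝ => (q.1, q.2, pt q.1 q.2 ω)) (x := (s, r))
    (continuousAt_score hm hr (pt s r ω)) hc.continuousAt

/-- A square-integrable local majorant of the score. -/
lemma exists_score_bound (hm : SecondMoments π) {r : ℝ} (hr : 0 < r) (s : ℝ) :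
    ∃ B : (Eucl n × Eucl n) × Eucl n → ℝ, MemLp B 2 (PG π) ∧
      ∀ᶠ q : ℝ × ℝ in 𝓝 (s, r), 0 < q.2 ∧ ∀ ω, ‖score π q.1 q.2 (pt q.1 q.2 ω)‖ ≤ B ω := by
  refine ⟨fun ω => ((‖ω.1.1‖ + (|s| + 1) * ‖ω.1.2 - ω.1.1‖ + √(2 * r) * ‖ω.2‖)
    + (∫ p, ‖p.1‖ ∂π + (|s| + 1) * ∫ p, ‖p.2 - p.1‖ ∂π)) * (r / 2)⁻¹, ?_, ?_⟩
  · exact ((((hm.memLp_fst.norm.add (hm.memLp_vel.norm.const_mul _)).add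
      (memLp_noise.norm.const_mul _)).add (memLp_const _)).mul_const _)
  · have hev : ∀ᶠ q : ℝ × ℝ in 𝓝 (s, r), r / 2 < q.2 :=
      (continuous_snd.tendsto (s, r)).eventually (lt_mem_nhds (by simp; linarith))
    have hev2 : ∀ᶠ q : ℝ × ℝ in 𝓝 (s, r), q.2 < 2 * r :=
      (continuous_snd.tendsto (s, r)).eventually (gt_mem_nhds (by simp; linarith))
    have hev3 : ∀ᶠ q : ℝ × ℝ in 𝓝 (s, r), |q.1| < |s| + 1 :=
      (continuous_fst.abs.tendsto (s, r)).eventually (gt_mem_nhds (by simp))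
    filter_upwards [hev, hev2, hev3] with q h1 h2 h3
    have hq : 0 < q.2 := by linarith
    refine ⟨hq, fun ω => (norm_score_le hm hq _ _).trans ?_⟩
    rw [div_eq_mul_inv]
    have hpt : ‖pt q.1 q.2 ω‖ ≤
        ‖ω.1.1‖ + (|s| + 1) * ‖ω.1.2 - ω.1.1‖ + √(2 * r) * ‖ω.2‖ := by
      refine (norm_pt_le _ _ _).trans ?_
      gcongr
    have hi : 0 ≤ ∫ p, ‖p.1‖ ∂π := integral_nonneg fun _ => norm_nonneg _
    have hi' : 0 ≤ ∫ p, ‖p.2 - p.1‖ ∂π := integral_nonneg fun _ => norm_nonneg _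
    gcongr

lemma continuousAt_slopeV (hm : SecondMoments π) {r : ℝ} (hr : 0 < r) (s : ℝ) :
    ContinuousAt (fun q : ℝ × ℝ => slopeV π q.1 q.2) (s, r) := by
  obtain ⟨B, hB, hev⟩ := exists_score_bound hm hr s
  refine continuousAt_of_dominated (bound := fun ω => ‖ω.1.2 - ω.1.1‖ * B ω) ?_ ?_ ?_
    (ae_of_all _ fun ω => ?_)
  · filter_upwards [hev] with q hq
    exact hm.memLp_vel.1.inner (hm.memLp_score hq.1 q.1).1
  · filter_upwards [hev] with q hq
    refine ae_of_all _ fun ω => (norm_inner_le_norm _ _).trans ?_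
    gcongr
    exact hq.2 ω
  · exact hm.memLp_vel.norm.integrable_mul hB
  · exact continuousAt_const.inner (continuousAt_score_pt hm hr s ω)

lemma continuousAt_fisher (hm : SecondMoments π) {r : ℝ} (hr : 0 < r) (s : ℝ) :
    ContinuousAt (fun q : ℝ × ℝ => fisher π q.1 q.2) (s, r) := by
  obtain ⟨B, hB, hev⟩ := exists_score_bound hm hr s
  refine continuousAt_of_dominated (bound := fun ω => B ω ^ 2) ?_ ?_ hB.integrable_sq
    (ae_of_all _ fun ω => ?_)
  · filter_upwards [hev] with q hq
    exact (integrable_normSq_of_memLp_two (hm.memLp_score hq.1 q.1)).1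
  · filter_upwards [hev] with q hq
    refine ae_of_all _ fun ω => ?_
    rw [Real.norm_of_nonneg (by positivity)]
    gcongr
    exact hq.2 ω
  · exact (continuousAt_score_pt hm hr s ω).norm.pow 2

lemma continuousAt_slope (hm : SecondMoments π) {r : ℝ} (hr : 0 < r) (s c : ℝ) :
    ContinuousAt (fun q : ℝ × ℝ × ℝ => slope π q.1 q.2.1 q.2.2) (s, r, c) := by
  unfold slope
  have hc : ContinuousAt (fun q : ℝ × ℝ × ℝ => (q.1, q.2.1)) (s, r, c) := by fun_prop
  have h1 := ContinuousAt.comp (x := (s, r, c)) (f := fun q : ℝ × ℝ × ℝ => (q.1, q.2.1))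
    (continuousAt_slopeV hm hr s) hc
  have h2 := ContinuousAt.comp (x := (s, r, c)) (f := fun q : ℝ × ℝ × ℝ => (q.1, q.2.1))
    (continuousAt_fisher hm hr s) hc
  exact h1.add (ContinuousAt.mul (by fun_prop) h2)

end

section

variable {n : ℕ} {π : Measure (Eucl n × Eucl n)} [IsProbabilityMeasure π]

/-- Semiconvexity of the logarithm of a Gaussian mixture. -/
lemma le_log_dens (hm : SecondMoments π) {r : ℝ} (hr : 0 < r) (s : ℝ) (x y : Eucl n) :
    Real.log (dens π s r x) - ⟪score π s r x, y - x⟫ - ‖y - x‖ ^ 2 / (2 * r)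
      ≤ Real.log (dens π s r y) := by
  have hdx := dens_pos (π := π) hr s x
  have hdy := dens_pos (π := π) hr s y
  set m := - ⟪score π s r x, y - x⟫ - ‖y - x‖ ^ 2 / (2 * r) with hmd
  have hi0 := integrable_gaussKer_sub_line (π := π) hr s x
  have hi1 := (integrable_scoreNum hm hr s x).const_inner (𝕜 := ℝ) (y - x)
  set K := ⟪score π s r x, y - x⟫ with hK
  have hpt : ∀ p, Real.exp m * (gaussKer n r (x - line s p) * (1 + K)
      - r⁻¹ * ⟪y - x, gaussKer n r (x - line s p) • (x - line s p)⟫)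
        ≤ gaussKer n r (y - line s p) := by
    intro p
    have hx : (y - line s p) = (x - line s p) + (y - x) := by abel
    have e : gaussKer n r (y - line s p) = gaussKer n r (x - line s p) *
        (Real.exp m * Real.exp (K - r⁻¹ * ⟪y - x, x - line s p⟫)) := by
      rw [← Real.exp_add, gaussKer, gaussKer, div_mul_eq_mul_div, ← Real.exp_add, hx,
        norm_add_sq_real, real_inner_comm]
      congr 2
      rw [hmd]
      field_simp
      ring
    rw [e, real_inner_smul_right]
    have h1 := Real.add_one_le_exp (K - r⁻¹ * ⟪y - x, x - line s p⟫)
    have h2 := mul_le_mul_of_nonneg_left h1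
      (mul_pos (gaussKer_pos hr (x - line s p)) (Real.exp_pos m)).le
    linarith
  have h := integral_mono (((hi0.mul_const (1 + K)).sub (hi1.const_mul r⁻¹)).const_mul
    (Real.exp m)) (integrable_gaussKer_sub_line hr s y) hpt
  rw [integral_const_mul, integral_sub' (hi0.mul_const (1 + K)) (hi1.const_mul r⁻¹),
    integral_mul_const, integral_const_mul, integral_inner (integrable_scoreNum hm hr s x)] at h
  change Real.exp m * (dens π s r x * (1 + K) - r⁻¹ * ⟪y - x, scoreNum π s r x⟫)
    ≤ dens π s r y at h
  have hs : r⁻¹ * ⟪y - x, scoreNum π s r x⟫ = dens π s r x * K := by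
    rw [hK, score, real_inner_smul_left, real_inner_comm]
    field_simp
  rw [hs] at h
  have h' : Real.exp m * dens π s r x ≤ dens π s r y := by linarith
  have := Real.log_le_log (by positivity) h'
  rw [Real.log_mul (Real.exp_pos m).ne' hdx.ne', Real.log_exp] at this
  linarith

lemma integrable_log_dens (hm : SecondMoments π) {r : ℝ} (hr : 0 < r) (s s' r' : ℝ) :
    Integrable (fun ω => Real.log (dens π s r (pt s' r' ω))) (PG π) := by
  set A := 1 / (2 * Real.pi * r) ^ ((n : ℝ) / 2)
  have h1 := (hm.memLp_pt s' r').integrable (by norm_num)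
  have h2 := integrable_normSq_of_memLp_two (hm.memLp_pt s' r')
  refine (((integrable_const (|Real.log A| + |Real.log (dens π s r 0)|)).add
    (h1.norm.const_mul ‖score π s r 0‖)).add (h2.div_const (2 * r))).mono' ?_
    (ae_of_all _ fun ω => ?_)
  · exact (Real.measurable_log.comp ((continuous_dens hr s).measurable.comp
      (continuous_pt s' r').measurable)).aestronglyMeasurable
  · simp only [Pi.add_apply]
    set y := pt s' r' ω
    have hlow := le_log_dens hm hr s 0 y
    have hup := Real.log_le_log (dens_pos (π := π) hr s y) (dens_le hr s y)
    have hin := real_inner_le_norm (score π s r 0) (y - 0)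
    rw [sub_zero] at hlow hin
    have h3 : 0 ≤ ‖score π s r 0‖ * ‖y‖ := by positivity
    have h4 : 0 ≤ ‖y‖ ^ 2 / (2 * r) := by positivity
    have h5 := neg_abs_le (Real.log (dens π s r 0))
    have h6 := le_abs_self (Real.log A)
    have h7 := abs_nonneg (Real.log A)
    have h8 := abs_nonneg (Real.log (dens π s r 0))
    rw [Real.norm_eq_abs, abs_le]
    constructor
    · linarith
    · have : Real.log (dens π s r y) ≤ Real.log A := hup
      linarith

lemma isProbabilityMeasure_dens {r : ℝ} (hr : 0 < r) (s : ℝ) :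
    IsProbabilityMeasure (densMeas n (dens π s r)) := by
  rw [← map_pt hr]
  exact Measure.isProbabilityMeasure_map (continuous_pt s r).measurable.aemeasurable

lemma lintegral_dens {r : ℝ} (hr : 0 < r) (s : ℝ) :
    ∫⁻ x, ENNReal.ofReal (dens π s r x) = 1 := by
  have h := (isProbabilityMeasure_dens (π := π) hr s).measure_univ
  rwa [densMeas, withDensity_apply _ MeasurableSet.univ, Measure.restrict_univ] at h

lemma integrable_dens {r : ℝ} (hr : 0 < r) (s : ℝ) : Integrable (dens π s r) := by
  refine ⟨(continuous_dens hr s).aestronglyMeasurable, ?_⟩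
  rw [hasFiniteIntegral_iff_ofReal (ae_of_all _ fun x => (dens_pos hr s x).le), lintegral_dens hr]
  exact ENNReal.one_lt_top

lemma integral_dens {r : ℝ} (hr : 0 < r) (s : ℝ) : ∫ x, dens π s r x = 1 := by
  rw [integral_eq_lintegral_of_nonneg_ae (ae_of_all _ fun x => (dens_pos hr s x).le)
    (continuous_dens hr s).aestronglyMeasurable, lintegral_dens hr, ENNReal.toReal_one]

lemma integral_comp_pt {r : ℝ} (hr : 0 < r) (s : ℝ) {F : Eucl n → ℝ} (hF : Measurable F) :
    ∫ ω, F (pt s r ω) ∂(PG π) = ∫ x, dens π s r x * F x := by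
  rw [← integral_map (φ := pt s r) (continuous_pt s r).measurable.aemeasurable
    hF.aestronglyMeasurable, map_pt hr, densMeas, integral_withDensity_eq_integral_toReal_smul
      (continuous_dens hr s).measurable.ennreal_ofReal (ae_of_all _ fun _ => by simp)]
  simp_rw [ENNReal.toReal_ofReal (dens_pos hr s _).le, smul_eq_mul]

lemma integrable_comp_pt {r : ℝ} (hr : 0 < r) (s : ℝ) {F : Eucl n → ℝ} (hF : Measurable F) :
    Integrable (fun ω => F (pt s r ω)) (PG π) ↔ Integrable (fun x => dens π s r x * F x) := by
  have h := integrable_map_measure (μ := PG π) (f := pt s r) (g := F) hF.aestronglyMeasurable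
    (continuous_pt s r).measurable.aemeasurable
  rw [map_pt hr, densMeas, integrable_withDensity_iff_integrable_smul'
    (continuous_dens hr s).measurable.ennreal_ofReal (ae_of_all _ fun _ => by simp)] at h
  simp_rw [ENNReal.toReal_ofReal (dens_pos hr s _).le, smul_eq_mul] at h
  exact h.symm

/-- Gibbs' inequality. -/
lemma integral_log_dens_le (hm : SecondMoments π) {r r' : ℝ} (hr : 0 < r) (hr' : 0 < r')
    (s s' : ℝ) : ∫ ω, Real.log (dens π s r (pt s' r' ω)) ∂(PG π) ≤ -ent π s' r' := by
  have hF : Measurable fun x => dens π s r x / dens π s' r' x :=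
    (continuous_dens hr s).measurable.div (continuous_dens hr' s').measurable
  have hc : ∀ x, dens π s' r' x * (dens π s r x / dens π s' r' x) = dens π s r x := fun x => by
    have := dens_pos (π := π) hr' s' x
    field_simp
  have hFi := (integrable_comp_pt (π := π) hr' s' hF).2 (by
    simp_rw [hc]; exact integrable_dens hr s)
  have hF1 : ∫ ω, dens π s r (pt s' r' ω) / dens π s' r' (pt s' r' ω) ∂(PG π) = 1 := by
    rw [integral_comp_pt hr' s' hF]
    simp_rw [hc]
    exact integral_dens hr s
  have hi1 := integrable_log_dens hm hr s s' r'
  have hi2 := integrable_log_dens hm hr' s' s' r'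
  have h := integral_mono (hi1.sub hi2) (hFi.sub (integrable_const 1)) (fun ω => by
    have h1 := dens_pos (π := π) hr s (pt s' r' ω)
    have h2 := dens_pos (π := π) hr' s' (pt s' r' ω)
    simp only [Pi.sub_apply]
    rw [← Real.log_div h1.ne' h2.ne']
    exact Real.log_le_sub_one_of_pos (div_pos h1 h2))
  rw [integral_sub' hi1 hi2, integral_sub' hFi (integrable_const 1), hF1] at h
  simp only [integral_const, probReal_univ, smul_eq_mul, mul_one, sub_self] at h
  unfold ent
  linarith

lemma ent_le (hm : SecondMoments π) {r r' : ℝ} (hr : 0 < r) (hr' : 0 < r') (s s' : ℝ) :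
    ent π s' r' ≤ ent π s r + (s' - s) * (slopeV π s r + (s' - s) * (velSq π / r))
      + (√r' - √r) * (√r * fisher π s r + (√r' - √r) * (n / r)) := by
  have hV := integrable_normSq_of_memLp_two hm.memLp_vel
  have hN := integrable_normSq_of_memLp_two (memLp_noise (π := π))
  have hVS := integrable_inner_of_memLp_two hm.memLp_vel (hm.memLp_score hr s)
  have hNS := integrable_inner_of_memLp_two (memLp_noise (π := π)) (hm.memLp_score hr s)
  have hL := integrable_log_dens hm hr s s r
  have hL' := integrable_log_dens hm hr s s' r'
  have hS := (hVS.const_mul (s' - s)).add (hNS.const_mul (√r' - √r))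
  have hQ := (hV.const_mul ((s' - s) ^ 2 / r)).add (hN.const_mul ((√r' - √r) ^ 2 / r))
  have h := integral_mono ((hL.sub hS).sub hQ) hL' (fun ω => by
    refine le_trans ?_ (le_log_dens hm hr s (pt s r ω) (pt s' r' ω))
    have hd : pt s' r' ω - pt s r ω = (s' - s) • (ω.1.2 - ω.1.1) + (√r' - √r) • ω.2 := by
      simp only [pt, line, sub_smul]
      abel
    set V := ω.1.2 - ω.1.1
    set S := score π s r (pt s r ω)
    have hn : ‖pt s' r' ω - pt s r ω‖ ^ 2
        ≤ 2 * ((s' - s) ^ 2 * ‖V‖ ^ 2 + (√r' - √r) ^ 2 * ‖ω.2‖ ^ 2) := by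
      have h1 := parallelogram_law_with_norm ℝ ((s' - s) • V) ((√r' - √r) • ω.2)
      have h2 := mul_self_nonneg ‖(s' - s) • V - (√r' - √r) • ω.2‖
      rw [hd, pow_two]
      simp only [norm_smul, Real.norm_eq_abs] at h1
      have h3 := sq_abs (s' - s)
      have h4 := sq_abs (√r' - √r)
      nlinarith [h1, h2]
    have hn' : ‖pt s' r' ω - pt s r ω‖ ^ 2 / (2 * r)
        ≤ (s' - s) ^ 2 / r * ‖V‖ ^ 2 + (√r' - √r) ^ 2 / r * ‖ω.2‖ ^ 2 := by
      rw [div_le_iff₀ (by positivity)]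
      refine hn.trans (le_of_eq ?_)
      field_simp
    have hi : ⟪S, pt s' r' ω - pt s r ω⟫ = (s' - s) * ⟪V, S⟫ + (√r' - √r) * ⟪ω.2, S⟫ := by
      rw [hd, real_inner_comm, inner_add_left, real_inner_smul_left, real_inner_smul_left]
    rw [hi]
    simp only [Pi.sub_apply, Pi.add_apply]
    linarith)
  rw [integral_sub' (hL.sub hS) hQ, integral_sub' hL hS,
    integral_add' (hVS.const_mul _) (hNS.const_mul _),
    integral_add' (hV.const_mul _) (hN.const_mul _), integral_const_mul, integral_const_mul,
    integral_const_mul, integral_const_mul, integral_normSq_noise, integral_normSq_vel,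
    integral_inner_noise_score hm hr] at h
  have h2 := h.trans (integral_log_dens_le hm hr hr' s s')
  have h3 : ∫ ω, Real.log (dens π s r (pt s r ω)) ∂(PG π) = -ent π s r := by
    rw [ent, neg_neg]
  rw [h3] at h2
  change -ent π s r - ((s' - s) * slopeV π s r + _) - _ ≤ _ at h2
  have e1 : (s' - s) ^ 2 / r * velSq π = (s' - s) * ((s' - s) * (velSq π / r)) := by ring
  have e2 : (√r' - √r) ^ 2 / r * n = (√r' - √r) * ((√r' - √r) * (n / r)) := by ring
  rw [e1, e2] at h2
  linarith

lemma continuousAt_ent (hm : SecondMoments π) {r : ℝ} (hr : 0 < r) (s : ℝ) :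
    ContinuousAt (fun q : ℝ × ℝ => ent π q.1 q.2) (s, r) := by
  have hev : ∀ᶠ q : ℝ × ℝ in 𝓝 (s, r), 0 < q.2 :=
    (continuous_snd.tendsto (s, r)).eventually (lt_mem_nhds hr)
  have hV := continuousAt_slopeV hm hr s
  have hF := continuousAt_fisher hm hr s
  have hr0 : (s, r).2 ≠ 0 := hr.ne'
  have hlow : ContinuousAt (fun q : ℝ × ℝ => ent π s r
      - (s - q.1) * (slopeV π q.1 q.2 + (s - q.1) * (velSq π / q.2))
      - (√r - √q.2) * (√q.2 * fisher π q.1 q.2 + (√r - √q.2) * (n / q.2))) (s, r) := by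
    have h1 : ContinuousAt (fun q : ℝ × ℝ => velSq π / q.2) (s, r) :=
      continuousAt_const.div (by fun_prop) hr0
    have h2 : ContinuousAt (fun q : ℝ × ℝ => (n : ℝ) / q.2) (s, r) :=
      continuousAt_const.div (by fun_prop) hr0
    fun_prop
  have hup : ContinuousAt (fun q : ℝ × ℝ => ent π s r
      + (q.1 - s) * (slopeV π s r + (q.1 - s) * (velSq π / r))
      + (√q.2 - √r) * (√r * fisher π s r + (√q.2 - √r) * (n / r))) (s, r) := by
    fun_prop
  have hlow' := hlow.tendsto
  have hup' := hup.tendsto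
  simp only [sub_self, zero_mul, sub_zero, add_zero] at hlow' hup'
  refine tendsto_of_tendsto_of_tendsto_of_le_of_le' hlow' hup' ?_ ?_
  · filter_upwards [hev] with q hq
    have := ent_le hm hq hr q.1 s
    linarith
  · filter_upwards [hev] with q hq
    exact ent_le hm hr hq s q.1

lemma hasDerivAt_sub_mul {Q F : ℝ → ℝ} {s q : ℝ} (hQ : HasDerivAt Q q s)
    (hF : ContinuousAt F s) : HasDerivAt (fun x => (Q x - Q s) * F x) (q * F s) s := by
  rw [hasDerivAt_iff_tendsto_slope] at hQ ⊢
  refine (hQ.mul (hF.tendsto.mono_left nhdsWithin_le_nhds)).congr fun x => ?_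
  simp only [_root_.slope, vsub_eq_sub, smul_eq_mul]
  ring

lemma hasDerivAt_of_squeeze {f l u : ℝ → ℝ} {s d : ℝ} (hl : HasDerivAt l d s)
    (hu : HasDerivAt u d s) (hl0 : l s = 0) (hu0 : u s = 0)
    (hlf : ∀ᶠ x in 𝓝 s, l x ≤ f x - f s) (hfu : ∀ᶠ x in 𝓝 s, f x - f s ≤ u x) :
    HasDerivAt f d s := by
  rw [hasDerivAt_iff_isLittleO] at hl hu ⊢
  refine Asymptotics.IsLittleO.of_bound fun c hc => ?_
  filter_upwards [hl.bound hc, hu.bound hc, hlf, hfu] with x h1 h2 h3 h4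
  rw [Real.norm_eq_abs, Real.norm_eq_abs, smul_eq_mul] at *
  rw [abs_le] at *
  rw [hl0] at h1
  rw [hu0] at h2
  constructor <;> linarith [h1.1, h1.2, h2.1, h2.2]

/-- The derivative of the entropy along a curve of variances. -/
lemma hasDerivAt_ent (hm : SecondMoments π) {R : ℝ → ℝ} {s c : ℝ} (hR : HasDerivAt R c s)
    (hpos : 0 < R s) : HasDerivAt (fun x => ent π x (R x)) (slope π s (R s) c) s := by
  have hQ : HasDerivAt (fun x => √(R x)) (c / (2 * √(R s))) s := hR.sqrt hpos.ne'
  have hev : ∀ᶠ x in 𝓝 s, 0 < R x := hR.continuousAt.eventually (lt_mem_nhds hpos)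
  have hRc := hR.continuousAt
  have hpair : ContinuousAt (fun x => (x, R x)) s := continuousAt_id.prodMk hRc
  have hV : ContinuousAt (fun x => slopeV π x (R x)) s :=
    ContinuousAt.comp (f := fun x => (x, R x)) (continuousAt_slopeV hm hpos s) hpair
  have hF : ContinuousAt (fun x => fisher π x (R x)) s :=
    ContinuousAt.comp (f := fun x => (x, R x)) (continuousAt_fisher hm hpos s) hpair
  have hQc : ContinuousAt (fun x => √(R x)) s := hQ.continuousAt
  have h1 : ContinuousAt (fun x => velSq π / R x) s := continuousAt_const.div hRc hpos.ne'
  have h2 : ContinuousAt (fun x => (n : ℝ) / R x) s := continuousAt_const.div hRc hpos.ne'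
  have hid := hasDerivAt_id s
  have hsq := (Real.sqrt_pos.2 hpos).ne'
  have hu := (hasDerivAt_sub_mul hid (F := fun x => slopeV π s (R s) + (x - s) * (velSq π / R s))
      (by fun_prop)).add (hasDerivAt_sub_mul hQ (F := fun x => √(R s) * fisher π s (R s)
        + (√(R x) - √(R s)) * (n / R s)) (by fun_prop))
  have hl := (hasDerivAt_sub_mul hid (F := fun x => slopeV π x (R x) - (x - s) * (velSq π / R x))
      (by fun_prop)).add (hasDerivAt_sub_mul hQ (F := fun x => √(R x) * fisher π x (R x)
        - (√(R x) - √(R s)) * (n / R x)) (by fun_prop))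
  refine hasDerivAt_of_squeeze (hl.congr_deriv ?_) (hu.congr_deriv ?_) (by simp) (by simp) ?_ ?_
  · simp only [slope, sub_self, zero_mul, sub_zero]
    field_simp
  · simp only [slope, sub_self, zero_mul, add_zero]
    field_simp
  · filter_upwards [hev] with x hx
    have := ent_le hm hx hpos x s
    simp only [Pi.add_apply, id]
    linarith
  · filter_upwards [hev] with x hx
    have := ent_le hm hpos hx s x
    simp only [Pi.add_apply, id]
    linarith

end

section

variable {n : ℕ}

lemma integral_add_mul {α : Type*} [MeasurableSpace α] {μ : Measure α} {f g : α → ℝ}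
    (hf : Integrable f μ) (hg : Integrable g μ) (c : ℝ) :
    ∫ x, (f x + c * g x) ∂μ = ∫ x, f x ∂μ + c * ∫ x, g x ∂μ := by
  rw [integral_add hf (hg.const_mul c), integral_const_mul]

lemma integral_add_mul_add_mul {α : Type*} [MeasurableSpace α] {μ : Measure α} {f g h : α → ℝ}
    (hf : Integrable f μ) (hg : Integrable g μ) (hh : Integrable h μ) (c d : ℝ) :
    ∫ x, (f x + c * g x + d * h x) ∂μ
      = ∫ x, f x ∂μ + c * ∫ x, g x ∂μ + d * ∫ x, h x ∂μ := by
  have hfg : Integrable (fun x => f x + c * g x) μ := hf.add (hg.const_mul c)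
  rw [integral_add_mul hfg hh, integral_add_mul hf hg]

/-- The kinetic energy of the projected velocity field is at most `β`. -/
def EnergyLe (π : Measure (Eucl n × Eucl n)) (s r c β : ℝ) : Prop :=
  ∀ f : Eucl n → Eucl n, Measurable f → MemLp (fun ω => f (pt s r ω)) 2 (PG π) →
    2 * ∫ ω, ⟪vel r c ω, f (pt s r ω)⟫ ∂(PG π) - ∫ ω, ‖f (pt s r ω)‖ ^ 2 ∂(PG π) ≤ β

lemma EnergyLe.mono {π : Measure (Eucl n × Eucl n)} {s r c β β' : ℝ} (h : EnergyLe π s r c β)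
    (hβ : β ≤ β') : EnergyLe π s r c β' := fun f hf hf2 => (h f hf hf2).trans hβ

lemma EnergyLe.nonneg {π : Measure (Eucl n × Eucl n)} {s r c β : ℝ} (h : EnergyLe π s r c β) :
    0 ≤ β := by
  simpa using h 0 measurable_const (by simp)

variable {π : Measure (Eucl n × Eucl n)} [IsProbabilityMeasure π]

lemma SecondMoments.memLp_vel_full (hm : SecondMoments π) (r c : ℝ) :
    MemLp (vel r c) 2 (PG π) :=
  hm.memLp_vel.add (memLp_noise.const_smul (c / (2 * √r)))

lemma energyLe_velSq (hm : SecondMoments π) (s r : ℝ) : EnergyLe π s r 0 (velSq π) := by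
  intro f hf hf2
  have h1 := integrable_inner_of_memLp_two (hm.memLp_vel_full r 0) hf2
  have h2 := integrable_normSq_of_memLp_two hf2
  have h3 := integrable_normSq_of_memLp_two hm.memLp_vel
  have h := integral_mono ((h1.const_mul 2).sub h2) h3 (fun ω => by
    have h4 : 0 ≤ ‖(ω.1.2 - ω.1.1) - f (pt s r ω)‖ ^ 2 := by positivity
    rw [norm_sub_sq_real] at h4
    simp only [Pi.sub_apply, vel, zero_div, zero_smul, add_zero]
    linarith)
  rwa [integral_sub' (h1.const_mul 2) h2, integral_const_mul, integral_normSq_vel] at h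

/-- Changing the growth rate of the variance. -/
lemma EnergyLe.add_rate (hm : SecondMoments π) {s r c β : ℝ} (hr : 0 < r)
    (h : EnergyLe π s r c β) (Δ : ℝ) :
    EnergyLe π s r (c + Δ) (β + Δ * slope π s r c + Δ ^ 2 / 4 * fisher π s r) := by
  intro f hf hf2
  have hS := hm.memLp_score hr s
  have hv := hm.memLp_vel_full r c
  have h1 := integrable_inner_of_memLp_two hv hf2
  have h2 := integrable_normSq_of_memLp_two hf2
  have h3 := integrable_inner_of_memLp_two hv hS
  have h4 := integrable_normSq_of_memLp_two hS
  have h5 := integrable_inner_of_memLp_two hS hf2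
  have h6 := integrable_inner_of_memLp_two (memLp_noise (π := π)) hf2
  have h0 := h (fun x => f x - (Δ / 2) • score π s r x)
    (hf.sub ((continuous_score hm hr s).measurable.const_smul (Δ / 2)))
    (hf2.sub (hS.const_smul (Δ / 2)))
  have e1 : ∫ ω, ⟪vel r c ω, f (pt s r ω) - (Δ / 2) • score π s r (pt s r ω)⟫ ∂(PG π)
      = ∫ ω, ⟪vel r c ω, f (pt s r ω)⟫ ∂(PG π) - Δ / 2 * slope π s r c := by
    simp only [inner_sub_right, real_inner_smul_right]
    rw [integral_sub h1 (h3.const_mul _), integral_const_mul, integral_inner_vel_score hm hr]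
  have e2 : ∫ ω, ‖f (pt s r ω) - (Δ / 2) • score π s r (pt s r ω)‖ ^ 2 ∂(PG π)
      = ∫ ω, ‖f (pt s r ω)‖ ^ 2 ∂(PG π)
        - Δ * ∫ ω, ⟪score π s r (pt s r ω), f (pt s r ω)⟫ ∂(PG π)
        + Δ ^ 2 / 4 * fisher π s r := by
    have : ∀ ω, ‖f (pt s r ω) - (Δ / 2) • score π s r (pt s r ω)‖ ^ 2
        = ‖f (pt s r ω)‖ ^ 2 + -Δ * ⟪score π s r (pt s r ω), f (pt s r ω)⟫
          + Δ ^ 2 / 4 * ‖score π s r (pt s r ω)‖ ^ 2 := by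
      intro ω
      rw [norm_sub_sq_real, real_inner_smul_right, norm_smul, mul_pow, Real.norm_eq_abs, sq_abs,
        real_inner_comm]
      ring
    simp_rw [this]
    rw [integral_add_mul_add_mul h2 h5 h4, fisher]
    ring
  have e3 : ∫ ω, ⟪vel r (c + Δ) ω, f (pt s r ω)⟫ ∂(PG π)
      = ∫ ω, ⟪vel r c ω, f (pt s r ω)⟫ ∂(PG π)
        + Δ / 2 * ∫ ω, ⟪score π s r (pt s r ω), f (pt s r ω)⟫ ∂(PG π) := by
    have : ∀ ω, ⟪vel r (c + Δ) ω, f (pt s r ω)⟫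
        = ⟪vel r c ω, f (pt s r ω)⟫ + Δ / (2 * √r) * ⟪ω.2, f (pt s r ω)⟫ := by
      intro ω
      rw [← real_inner_smul_left, ← inner_add_left, vel, vel, add_div, add_smul]
      congr 1
      abel
    simp_rw [this]
    rw [integral_add h1 (h6.const_mul _), integral_const_mul, integral_inner_noise hm hr s hf hf2]
    have := (Real.sqrt_pos.2 hr).ne'
    field_simp
  rw [e1, e2] at h0
  rw [e3]
  linarith

/-- Rotation of the noise and an additional independent Gaussian vector. -/
def rotNoise (θ : ℝ) (x : ((Eucl n × Eucl n) × Eucl n) × Eucl n) :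
    ((Eucl n × Eucl n) × Eucl n) × Eucl n :=
  ((x.1.1, Real.cos θ • x.1.2 + Real.sin θ • x.2), -Real.sin θ • x.1.2 + Real.cos θ • x.2)

lemma measurePreserving_rotNoise (θ : ℝ) :
    MeasurePreserving (rotNoise θ) ((PG π).prod (gam n)) ((PG π).prod (gam n)) := by
  have h1 : MeasurePreserving (ContinuousLinearMap.rotation (E := Eucl n) θ)
      ((gam n).prod (gam n)) ((gam n).prod (gam n)) :=
    ⟨(ContinuousLinearMap.rotation θ).continuous.measurable, map_rotation_gam θ⟩
  have h2 := (MeasurePreserving.id π).prod h1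
  have h3 := measurePreserving_prodAssoc π (gam n) (gam n)
  have h4 := (h3.symm _).comp (h2.comp h3)
  convert h4 using 1
  ext x <;> simp [rotNoise, MeasurableEquiv.prodAssoc, ContinuousLinearMap.rotation_apply]

lemma integral_inner_indep {Y : (Eucl n × Eucl n) × Eucl n → Eucl n} (hY : MemLp Y 2 (PG π)) :
    ∫ x, ⟪Y x.1, x.2⟫ ∂((PG π).prod (gam n)) = 0 := by
  have hi : Integrable (fun x : ((Eucl n × Eucl n) × Eucl n) × Eucl n => ⟪Y x.1, x.2⟫)
      ((PG π).prod (gam n)) :=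
    integrable_inner_of_memLp_two (hY.comp_measurePreserving measurePreserving_fst)
      (memLp_gam.comp_measurePreserving measurePreserving_snd)
  rw [integral_prod _ hi]
  simp [integral_inner integrable_gam]

/-- Enlarging the variance by the heat flow decreases the energy; the dimension enters through
the mean square of the added noise. -/
lemma EnergyLe.heat (hm : SecondMoments π) (hn : 1 ≤ n) {s r c β k : ℝ} (hr : 0 < r)
    (hk : 0 ≤ k) (h : EnergyLe π s r c β) :
    EnergyLe π s (r + k) c (β - k / n * slope π s (r + k) c ^ 2) := by
  intro f hf hf2
  have hn0 : (n : ℝ) ≠ 0 := by positivity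
  set R := r + k with hR
  have hR0 : 0 < R := by positivity
  set S := slope π s R c with hSdef
  set l : ℝ := S / n with hl
  have hS := hm.memLp_score hR0 s
  set Q := (PG π).prod (gam n) with hQ
  have hsR := Real.sqrt_pos.2 hR0
  have hsr := Real.sqrt_pos.2 hr
  obtain ⟨θ, hcos, hsin⟩ : ∃ θ : ℝ, √R * Real.cos θ = √r ∧ √R * Real.sin θ = √k := by
    have hkR : √k / √R ≤ 1 := by
      rw [div_le_one hsR]; exact Real.sqrt_le_sqrt (by linarith)
    have hkR' : -1 ≤ √k / √R := by linarith [show 0 ≤ √k / √R by positivity]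
    refine ⟨Real.arcsin (√k / √R), ?_, ?_⟩
    · rw [Real.cos_arcsin, ← Real.sqrt_mul hR0.le, div_pow, Real.sq_sqrt hk, Real.sq_sqrt hR0.le]
      congr 1
      field_simp
      linarith
    · rw [Real.sin_arcsin hkR' hkR]
      field_simp
  have hcs := Real.sin_sq_add_cos_sq θ
  have hT := measurePreserving_rotNoise (π := π) θ
  set g : Eucl n → Eucl n := fun x => f x + (l * k) • score π s R x with hg
  have hgm : Measurable g := hf.add ((continuous_score hm hR0 s).measurable.const_smul (l * k))
  have hg2 : MemLp (fun ω => g (pt s R ω)) 2 (PG π) := hf2.add (hS.const_smul (l * k))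
  have hfst : MeasurePreserving Prod.fst Q (PG π) := measurePreserving_fst
  have hsnd : MeasurePreserving Prod.snd Q (gam n) := measurePreserving_snd
  have hptT : ∀ x : ((Eucl n × Eucl n) × Eucl n) × Eucl n,
      pt s r x.1 + √k • x.2 = pt s R (rotNoise θ x).1 := by
    intro x
    simp only [pt, rotNoise, smul_add, smul_smul, hcos, hsin]
    abel
  have hG2 : MemLp (fun x => g (pt s r x.1 + √k • x.2)) 2 Q := by
    simp_rw [hptT]
    exact (hg2.comp_measurePreserving hfst).comp_measurePreserving hT
  have hz : MemLp (fun x : ((Eucl n × Eucl n) × Eucl n) × Eucl n => x.2) 2 Q :=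
    memLp_gam.comp_measurePreserving hsnd
  have hv : MemLp (fun x : ((Eucl n × Eucl n) × Eucl n) × Eucl n => vel r c x.1) 2 Q :=
    (hm.memLp_vel_full r c).comp_measurePreserving hfst
  have hD2 : MemLp (fun x => g (pt s r x.1 + √k • x.2) - (l * √k) • x.2) 2 Q :=
    hG2.sub (hz.const_smul (l * √k))
  -- the test field at a frozen value of the additional noise
  have hsec : ∀ᵐ z ∂(gam n),
      2 * ∫ ω, ⟪vel r c ω, g (pt s r ω + √k • z) - (l * √k) • z⟫ ∂(PG π)
        - ∫ ω, ‖g (pt s r ω + √k • z) - (l * √k) • z‖ ^ 2 ∂(PG π) ≤ β := by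
    have hi := (integrable_normSq_of_memLp_two hD2).prod_left_ae
    filter_upwards [hi] with z hz'
    have hmz : Measurable fun x => g (x + √k • z) - (l * √k) • z :=
      (hgm.comp (measurable_id.add_const _)).sub_const _
    refine h (fun x => g (x + √k • z) - (l * √k) • z) hmz ?_
    exact (memLp_two_iff_integrable_sq_norm
      (hmz.comp (continuous_pt s r).measurable).aestronglyMeasurable).2 hz'
  have hi1 := integrable_inner_of_memLp_two hv hD2
  have hi2 := integrable_normSq_of_memLp_two hD2
  have hmain : 2 * ∫ x, ⟪vel r c x.1, g (pt s r x.1 + √k • x.2) - (l * √k) • x.2⟫ ∂Q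
      - ∫ x, ‖g (pt s r x.1 + √k • x.2) - (l * √k) • x.2‖ ^ 2 ∂Q ≤ β := by
    rw [integral_prod_symm _ hi1, integral_prod_symm _ hi2, ← integral_const_mul,
      ← integral_sub (hi1.integral_prod_right.const_mul 2) hi2.integral_prod_right]
    have := integral_mono_ae ((hi1.integral_prod_right.const_mul 2).sub hi2.integral_prod_right)
      (integrable_const β) hsec
    simpa using this
  -- transporting integrals through the rotation
  have htr : ∀ F : ((Eucl n × Eucl n) × Eucl n) × Eucl n → ℝ, Integrable F Q →
      ∫ x, F (rotNoise θ x) ∂Q = ∫ x, F x ∂Q := by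
    intro F hF
    have := integral_map (μ := Q) (φ := rotNoise θ) (f := F) hT.measurable.aemeasurable
      (by rw [hT.map_eq]; exact hF.1)
    rw [hT.map_eq] at this
    exact this.symm
  have hfi : ∀ F : (Eucl n × Eucl n) × Eucl n → ℝ, ∫ x, F x.1 ∂Q = ∫ ω, F ω ∂(PG π) := by
    intro F
    simpa using integral_fun_fst (μ := PG π) (ν := gam n) F
  have hgz := integrable_inner_of_memLp_two (memLp_noise (π := π)) hg2
  have hg2' : MemLp (fun x : ((Eucl n × Eucl n) × Eucl n) × Eucl n => g (pt s R x.1)) 2 Q :=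
    hg2.comp_measurePreserving hfst
  have hgz2 := integrable_inner_of_memLp_two hg2' hz
  have hnz : Integrable (fun x : ((Eucl n × Eucl n) × Eucl n) × Eucl n =>
      ⟪x.1.2, g (pt s R x.1)⟫) Q := hgz.comp_fst (gam n)
  have hvR := integrable_inner_of_memLp_two (hm.memLp_vel_full R c) hg2
  have hvR' : Integrable (fun x : ((Eucl n × Eucl n) × Eucl n) × Eucl n =>
      ⟪vel R c x.1, g (pt s R x.1)⟫) Q := hvR.comp_fst (gam n)
  have a1 : ∫ x, ⟪vel r c x.1, g (pt s r x.1 + √k • x.2)⟫ ∂Q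
      = ∫ ω, ⟪vel R c ω, g (pt s R ω)⟫ ∂(PG π) := by
    have e : ∀ x : ((Eucl n × Eucl n) × Eucl n) × Eucl n,
        ⟪vel r c x.1, g (pt s r x.1 + √k • x.2)⟫
        = (fun y : ((Eucl n × Eucl n) × Eucl n) × Eucl n => ⟪vel R c y.1, g (pt s R y.1)⟫
          + -(c / (2 * √r) * Real.sin θ) * ⟪g (pt s R y.1), y.2⟫) (rotNoise θ x) := by
      intro x
      have hz1 : x.1.2 = Real.cos θ • (rotNoise θ x).1.2 - Real.sin θ • (rotNoise θ x).2 := by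
        simp only [rotNoise, smul_add, smul_smul]
        have : x.1.2 = (Real.sin θ ^ 2 + Real.cos θ ^ 2) • x.1.2 := by rw [hcs, one_smul]
        conv_lhs => rw [this]
        module
      have hc : c / (2 * √r) * Real.cos θ = c / (2 * √R) := by
        rw [← hcos]
        have : Real.cos θ ≠ 0 := by
          intro h0; rw [h0, mul_zero] at hcos; exact hsr.ne hcos
        field_simp
      have hvv : vel r c x.1 = vel R c (rotNoise θ x).1
          - (c / (2 * √r) * Real.sin θ) • (rotNoise θ x).2 := by
        have : vel r c x.1 = (x.1.1.2 - x.1.1.1) + (c / (2 * √r)) • x.1.2 := rfl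
        rw [this, hz1, smul_sub, smul_smul, smul_smul, hc, vel]
        simp only [rotNoise]
        abel
      simp only
      rw [hptT, hvv, inner_sub_left, real_inner_smul_left, real_inner_comm (rotNoise θ x).2]
      ring
    refine (integral_congr_ae (.of_forall e)).trans
      ((htr _ (hvR'.add (hgz2.const_mul _))).trans ((integral_add_mul hvR' hgz2 _).trans ?_))
    rw [integral_inner_indep hg2, mul_zero, add_zero,
      hfi fun ω => ⟪vel R c ω, g (pt s R ω)⟫]
  have a2 : ∫ x, ‖g (pt s r x.1 + √k • x.2)‖ ^ 2 ∂Q = ∫ ω, ‖g (pt s R ω)‖ ^ 2 ∂(PG π) := by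
    simp_rw [hptT]
    rw [htr (fun y => ‖g (pt s R y.1)‖ ^ 2) (integrable_normSq_of_memLp_two hg2'),
      hfi fun ω => ‖g (pt s R ω)‖ ^ 2]
  have a3 : ∫ x, ⟪g (pt s r x.1 + √k • x.2), x.2⟫ ∂Q
      = √k * ∫ ω, ⟪score π s R (pt s R ω), g (pt s R ω)⟫ ∂(PG π) := by
    have e : ∀ x : ((Eucl n × Eucl n) × Eucl n) × Eucl n,
        ⟪g (pt s r x.1 + √k • x.2), x.2⟫
        = (fun y : ((Eucl n × Eucl n) × Eucl n) × Eucl n =>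
          Real.sin θ * ⟪y.1.2, g (pt s R y.1)⟫ + Real.cos θ * ⟪g (pt s R y.1), y.2⟫)
            (rotNoise θ x) := by
      intro x
      have hz2 : x.2 = Real.sin θ • (rotNoise θ x).1.2 + Real.cos θ • (rotNoise θ x).2 := by
        simp only [rotNoise, smul_add, smul_smul]
        have : x.2 = (Real.sin θ ^ 2 + Real.cos θ ^ 2) • x.2 := by rw [hcs, one_smul]
        conv_lhs => rw [this]
        module
      simp only
      rw [hptT]
      conv_lhs => rw [hz2]
      rw [inner_add_right, real_inner_smul_right, real_inner_smul_right,
        real_inner_comm (rotNoise θ x).1.2]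
    refine (integral_congr_ae (.of_forall e)).trans
      ((htr _ ((hnz.const_mul _).add (hgz2.const_mul _))).trans
        ((integral_add_mul (hnz.const_mul _) hgz2 _).trans ?_))
    rw [integral_const_mul, integral_inner_indep hg2, mul_zero, add_zero, hfi fun ω => ⟪ω.2, g (pt s R ω)⟫,
      integral_inner_noise hm hR0 s hgm hg2, ← mul_assoc, mul_comm (Real.sin θ), hsin]
  have a4 : ∫ x, ⟪vel r c x.1, x.2⟫ ∂Q = 0 := integral_inner_indep (hm.memLp_vel_full r c)
  have a5 : ∫ x : ((Eucl n × Eucl n) × Eucl n) × Eucl n, ‖x.2‖ ^ 2 ∂Q = n := by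
    have := integral_fun_snd (μ := PG π) (ν := gam n) (fun z : Eucl n => ‖z‖ ^ 2)
    simpa [integral_normSq_gam] using this
  -- expansion of the quadratic form
  have b1 : ∫ x, ⟪vel r c x.1, g (pt s r x.1 + √k • x.2) - (l * √k) • x.2⟫ ∂Q
      = ∫ ω, ⟪vel R c ω, g (pt s R ω)⟫ ∂(PG π) := by
    simp only [inner_sub_right, real_inner_smul_right]
    rw [integral_sub (integrable_inner_of_memLp_two hv hG2)
      ((integrable_inner_of_memLp_two hv hz).const_mul _), integral_const_mul, a1, a4]
    ring
  have b2 : ∫ x, ‖g (pt s r x.1 + √k • x.2) - (l * √k) • x.2‖ ^ 2 ∂Q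
      = ∫ ω, ‖g (pt s R ω)‖ ^ 2 ∂(PG π)
        - 2 * l * k * ∫ ω, ⟪score π s R (pt s R ω), g (pt s R ω)⟫ ∂(PG π) + l ^ 2 * k * n := by
    have e : ∀ x : ((Eucl n × Eucl n) × Eucl n) × Eucl n,
        ‖g (pt s r x.1 + √k • x.2) - (l * √k) • x.2‖ ^ 2
        = ‖g (pt s r x.1 + √k • x.2)‖ ^ 2
          + -(2 * (l * √k)) * ⟪g (pt s r x.1 + √k • x.2), x.2⟫ + l ^ 2 * k * ‖x.2‖ ^ 2 := by
      intro x
      rw [norm_sub_sq_real, real_inner_smul_right, norm_smul, mul_pow, Real.norm_eq_abs, sq_abs,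
        mul_pow, Real.sq_sqrt hk]
      ring
    have j1 := integrable_normSq_of_memLp_two hG2
    have j2 := integrable_inner_of_memLp_two hG2 hz
    have j3 := integrable_normSq_of_memLp_two hz
    simp_rw [e]
    rw [integral_add_mul_add_mul j1 j2 j3, a2, a3, a5]
    have := Real.mul_self_sqrt hk
    linear_combination (-2 * l * ∫ ω, ⟪score π s R (pt s R ω), g (pt s R ω)⟫ ∂(PG π)) * this
  have k1 := integrable_inner_of_memLp_two (hm.memLp_vel_full R c) hf2
  have k2 := integrable_inner_of_memLp_two (hm.memLp_vel_full R c) hS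
  have k3 := integrable_inner_of_memLp_two hS hf2
  have k4 := integrable_normSq_of_memLp_two hS
  have k5 := integrable_normSq_of_memLp_two hf2
  have c1 : ∫ ω, ⟪vel R c ω, g (pt s R ω)⟫ ∂(PG π)
      = ∫ ω, ⟪vel R c ω, f (pt s R ω)⟫ ∂(PG π) + l * k * S := by
    simp only [hg, inner_add_right, real_inner_smul_right]
    rw [integral_add k1 (k2.const_mul _), integral_const_mul, integral_inner_vel_score hm hR0]
  have c2 : ∫ ω, ⟪score π s R (pt s R ω), g (pt s R ω)⟫ ∂(PG π)
      = ∫ ω, ⟪score π s R (pt s R ω), f (pt s R ω)⟫ ∂(PG π) + l * k * fisher π s R := by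
    simp only [hg, inner_add_right, real_inner_smul_right, real_inner_self_eq_norm_sq]
    rw [integral_add k3 (k4.const_mul _), integral_const_mul, fisher]
  have c3 : ∫ ω, ‖g (pt s R ω)‖ ^ 2 ∂(PG π)
      = ∫ ω, ‖f (pt s R ω)‖ ^ 2 ∂(PG π)
        + 2 * (l * k) * ∫ ω, ⟪score π s R (pt s R ω), f (pt s R ω)⟫ ∂(PG π)
        + (l * k) ^ 2 * fisher π s R := by
    have e : ∀ ω, ‖g (pt s R ω)‖ ^ 2 = ‖f (pt s R ω)‖ ^ 2
        + 2 * (l * k) * ⟪score π s R (pt s R ω), f (pt s R ω)⟫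
        + (l * k) ^ 2 * ‖score π s R (pt s R ω)‖ ^ 2 := by
      intro ω
      simp only [hg]
      rw [norm_add_sq_real, real_inner_smul_right, norm_smul, mul_pow, Real.norm_eq_abs, sq_abs,
        real_inner_comm]
      ring
    simp_rw [e]
    rw [integral_add_mul_add_mul k5 k3 k4, fisher]
  rw [b1, b2, c1, c2, c3] at hmain
  have hF := fisher_nonneg π s R
  have hlF : 0 ≤ (l * k) ^ 2 * fisher π s R := by positivity
  have hS2 : k / n * S ^ 2 = l * k * S := by rw [hl]; ring
  have hS3 : l ^ 2 * k * n = l * k * S := by rw [hl]; field_simp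
  rw [hS3] at hmain
  rw [hS2]
  linarith

end

section

variable {n : ℕ}

/-- There is a coupling of `μ` and `ν` with quadratic cost at most `c`. -/
def CouplingLe (μ ν : Measure (Eucl n)) (c : ℝ) : Prop :=
  ∃ ρ : Measure (Eucl n × Eucl n), Coupling ρ μ ν ∧
    MemLp (fun p : Eucl n × Eucl n => p.1 - p.2) 2 ρ ∧ ∫ p, ‖p.1 - p.2‖ ^ 2 ∂ρ ≤ c

lemma norm_integral_sq_le {α : Type*} [MeasurableSpace α] {μ : Measure α} [IsProbabilityMeasure μ]
    (F : α → Eucl n) (hF : AEStronglyMeasurable F μ) :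
    ‖∫ x, F x ∂μ‖ₑ ^ 2 ≤ ∫⁻ x, ‖F x‖ₑ ^ 2 ∂μ := by
  have h1 := enorm_integral_le_lintegral_enorm (μ := μ) F
  have h2 := eLpNorm_le_eLpNorm_of_exponent_le (μ := μ) (p := 1) (q := 2) (by norm_num) hF
  rw [eLpNorm_one_eq_lintegral_enorm] at h2
  have h3 := pow_le_pow_left₀ (by simp) (h1.trans h2) 2
  refine h3.trans (le_of_eq ?_)
  have := eLpNorm_nnreal_pow_eq_lintegral (μ := μ) (f := F) (p := 2) (by norm_num)
  simpa using this

lemma memLp_two_iff_lintegral {α : Type*} [MeasurableSpace α] {μ : Measure α} {F : α → Eucl n}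
    (hF : AEStronglyMeasurable F μ) : MemLp F 2 μ ↔ ∫⁻ x, ‖F x‖ₑ ^ 2 ∂μ < ∞ := by
  have := eLpNorm_nnreal_pow_eq_lintegral (μ := μ) (f := F) (p := 2) (by norm_num)
  simp only [NNReal.coe_ofNat, ENNReal.coe_ofNat, ENNReal.rpow_ofNat] at this
  rw [← this]
  constructor
  · intro h; exact ENNReal.pow_lt_top h.2
  · intro h; exact ⟨hF, by simpa [ENNReal.pow_lt_top_iff] using h⟩

lemma integral_normSq_eq_toReal {α : Type*} [MeasurableSpace α] {μ : Measure α} {F : α → Eucl n}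
    (hF : AEStronglyMeasurable F μ) : ∫ x, ‖F x‖ ^ 2 ∂μ = (∫⁻ x, ‖F x‖ₑ ^ 2 ∂μ).toReal := by
  have hm : AEStronglyMeasurable (fun x => ‖F x‖ ^ 2) μ := hF.norm.pow 2
  rw [integral_eq_lintegral_of_nonneg_ae (.of_forall fun x => by positivity) hm]
  congr 2 with x
  rw [ENNReal.ofReal_pow (norm_nonneg _), ofReal_norm]

/-- Transporting the first marginal of a coupling along a random displacement whose projection
has small energy. -/
lemma CouplingLe.step {Ω : Type*} [MeasurableSpace Ω] {P : Measure Ω} [IsProbabilityMeasure P]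
    {X V : Ω → Eucl n} (hX : Measurable X) (hV : Measurable V) (hV2 : MemLp V 2 P)
    {ν : Measure (Eucl n)} {c β d l : ℝ} (hl : 0 < l) (hd : 0 ≤ d) (hc : CouplingLe (P.map X) ν c)
    (hβ : ∀ f : Eucl n → Eucl n, Measurable f → MemLp (fun ω => f (X ω)) 2 P →
      2 * ∫ ω, ⟪V ω, f (X ω)⟫ ∂P - ∫ ω, ‖f (X ω)‖ ^ 2 ∂P ≤ β) :
    CouplingLe (P.map fun ω => X ω + d • V ω) ν
      (c + d * (β / l + l * c) + d ^ 2 * ∫ ω, ‖V ω‖ ^ 2 ∂P) := by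
  obtain ⟨ρ, ⟨hρ, hρ1, hρ2⟩, hm, hcost⟩ := hc
  set κ := ρ.condKernel with hκ
  have hdis : ρ.fst ⊗ₘ κ = ρ := ρ.disintegrate κ
  have hfst : ρ.fst = P.map X := hρ1
  set Q : Measure (Ω × Eucl n) := P ⊗ₘ (κ.comap X hX) with hQ
  have hQfst : MeasurePreserving Prod.fst Q P := ⟨measurable_fst, by
    have := Measure.fst_compProd P (κ.comap X hX)
    rwa [Measure.fst] at this⟩
  have hXs : Measurable fun z : Ω × Eucl n => (X z.1, z.2) :=
    (hX.comp measurable_fst).prodMk measurable_snd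
  have hQρ : MeasurePreserving (fun z : Ω × Eucl n => (X z.1, z.2)) Q ρ := by
    refine ⟨hXs, ?_⟩
    refine Measure.ext_of_lintegral _ fun F hF => ?_
    have hFX : Measurable fun z : Ω × Eucl n => F (X z.1, z.2) := hF.comp hXs
    rw [lintegral_map hF hXs, hQ, Measure.lintegral_compProd hFX, ← hdis,
      Measure.lintegral_compProd hF, hfst, lintegral_map hF.lintegral_kernel_prod_right' hX]
    rfl
  have : IsProbabilityMeasure Q := by rw [hQ]; infer_instance
  have hsub : Measurable fun p : Eucl n × Eucl n => p.1 - p.2 := by fun_prop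
  set fh : Eucl n → Eucl n := fun x => ∫ y, (x - y) ∂(κ x) with hfh
  have hfhm : Measurable fh :=
    (StronglyMeasurable.integral_kernel_prod_right' (κ := κ) hsub.stronglyMeasurable).measurable
  have hE : ∫⁻ ω, ‖fh (X ω)‖ₑ ^ 2 ∂P ≤ ∫⁻ p, ‖p.1 - p.2‖ₑ ^ 2 ∂ρ := by
    have hsq : Measurable fun p : Eucl n × Eucl n => ‖p.1 - p.2‖ₑ ^ 2 := by fun_prop
    have hsf : Measurable fun x => ‖fh x‖ₑ ^ 2 := by fun_prop
    rw [← lintegral_map (f := fun x => ‖fh x‖ₑ ^ 2) hsf hX, ← hfst]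
    conv_rhs => rw [← hdis, Measure.lintegral_compProd hsq]
    refine lintegral_mono fun x => ?_
    exact norm_integral_sq_le _ (by fun_prop)
  have hρlt := (memLp_two_iff_lintegral hm.1).1 hm
  have hfX : AEStronglyMeasurable (fun ω => fh (X ω)) P := (hfhm.comp hX).aestronglyMeasurable
  have hf2 : MemLp (fun ω => fh (X ω)) 2 P :=
    (memLp_two_iff_lintegral hfX).2 (hE.trans_lt hρlt)
  have hfle : ∫ ω, ‖fh (X ω)‖ ^ 2 ∂P ≤ c := by
    refine le_trans ?_ hcost
    rw [integral_normSq_eq_toReal hfX,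
      integral_normSq_eq_toReal hm.1]
    exact ENNReal.toReal_mono hρlt.ne hE
  have hZ : MemLp (fun z : Ω × Eucl n => X z.1 - z.2) 2 Q := hm.comp_measurePreserving hQρ
  have hVQ : MemLp (fun z : Ω × Eucl n => V z.1) 2 Q := hV2.comp_measurePreserving hQfst
  have hin := integrable_inner_of_memLp_two hVQ hZ
  have i1 : ∫ z, ⟪V z.1, X z.1 - z.2⟫ ∂Q = ∫ ω, ⟪V ω, fh (X ω)⟫ ∂P := by
    have hae : ∀ᵐ ω ∂P, Integrable (fun y => X ω - y) (κ.comap X hX ω) :=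
      ((Measure.integrable_compProd_iff hZ.1).1 (hZ.integrable (by norm_num))).1
    rw [hQ, Measure.integral_compProd hin]
    refine integral_congr_ae ?_
    filter_upwards [hae] with ω hω
    simp only
    rw [integral_inner hω]
    rfl
  have i2 : ∫ z, ‖X z.1 - z.2‖ ^ 2 ∂Q ≤ c := by
    refine le_trans (le_of_eq ?_) hcost
    conv_rhs => rw [← hQρ.map_eq]
    rw [integral_map hXs.aemeasurable (by fun_prop)]
  have i3 : ∫ z, ‖V z.1‖ ^ 2 ∂Q = ∫ ω, ‖V ω‖ ^ 2 ∂P := by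
    conv_rhs => rw [← hQfst.map_eq]
    rw [integral_map measurable_fst.aemeasurable (by fun_prop)]
  have hT : Measurable fun z : Ω × Eucl n => (X z.1 + d • V z.1, z.2) := by fun_prop
  refine ⟨Q.map fun z => (X z.1 + d • V z.1, z.2), ⟨Measure.isProbabilityMeasure_map hT.aemeasurable,
    ?_, ?_⟩, ?_, ?_⟩
  · rw [Measure.map_map measurable_fst hT]
    conv_rhs => rw [← hQfst.map_eq]
    rw [Measure.map_map (by fun_prop) measurable_fst]
    rfl
  · rw [Measure.map_map measurable_snd hT, ← hρ2]
    conv_rhs => rw [← hQρ.map_eq]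
    rw [Measure.map_map measurable_snd hXs]
    rfl
  · rw [memLp_map_measure_iff (by fun_prop) hT.aemeasurable]
    have := hZ.add (hVQ.const_smul d)
    refine this.congr_norm (by fun_prop) (.of_forall fun z => ?_)
    simp only [Pi.add_apply, Pi.smul_apply, Function.comp_apply]
    congr 1
    abel
  · rw [integral_map hT.aemeasurable (by fun_prop)]
    have e : ∀ z : Ω × Eucl n, ‖X z.1 + d • V z.1 - z.2‖ ^ 2
        = ‖X z.1 - z.2‖ ^ 2 + 2 * d * ⟪V z.1, X z.1 - z.2⟫ + d ^ 2 * ‖V z.1‖ ^ 2 := by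
      intro z
      have : X z.1 + d • V z.1 - z.2 = (X z.1 - z.2) + d • V z.1 := by abel
      rw [this, norm_add_sq_real, real_inner_smul_right, norm_smul, mul_pow, Real.norm_eq_abs,
        sq_abs, real_inner_comm]
      ring
    simp only [e]
    rw [integral_add_mul_add_mul (integrable_normSq_of_memLp_two hZ) hin
      (integrable_normSq_of_memLp_two hVQ), i1, i3]
    have hb := hβ (fun x => l • fh x) (hfhm.const_smul l) (hf2.const_smul l)
    simp only [real_inner_smul_right, norm_smul, mul_pow, Real.norm_eq_abs, sq_abs,
      integral_const_mul] at hb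
    have hk : 2 * ∫ ω, ⟪V ω, fh (X ω)⟫ ∂P ≤ β / l + l * c := by
      have h1 : l * (2 * ∫ ω, ⟪V ω, fh (X ω)⟫ ∂P) ≤ β + l ^ 2 * c := by
        have := mul_le_mul_of_nonneg_left hfle (sq_nonneg l)
        linarith
      have h2 : β / l + l * c = (β + l ^ 2 * c) / l := by field_simp
      rw [h2, le_div_iff₀ hl]
      linarith
    have := mul_le_mul_of_nonneg_left hk hd
    linarith

end

section

variable {n : ℕ}

/-- Uniform first order Taylor expansion on a compact interval. -/
lemma exists_taylor_bound {q q' : ℝ → ℝ} {a b η : ℝ} (hη : 0 < η)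
    (hq : ∀ s ∈ Icc a b, HasDerivAt q (q' s) s) (hq' : ContinuousOn q' (Icc a b)) :
    ∃ δ > 0, ∀ x ∈ Icc a b, ∀ y ∈ Icc a b, x ≤ y → y - x < δ →
      |q y - q x - (y - x) * q' x| ≤ η * (y - x) := by
  have hu := isCompact_Icc.uniformContinuousOn_of_continuous hq'
  obtain ⟨δ, hδ, h⟩ := Metric.uniformContinuousOn_iff.1 hu η hη
  refine ⟨δ, hδ, fun x hx y hy hxy hd => ?_⟩
  have hsub : ∀ z ∈ Icc x y, z ∈ Icc a b := fun z hz => ⟨hx.1.trans hz.1, hz.2.trans hy.2⟩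
  have h1 := (convex_Icc x y).norm_image_sub_le_of_norm_hasDerivWithin_le
    (f := fun z => q z - z * q' x) (f' := fun z => q' z - 1 * q' x) (C := η)
    (fun z hz => ((hq z (hsub z hz)).sub ((hasDerivAt_id z).mul_const _)).hasDerivWithinAt)
    (fun z hz => by
      have := h z (hsub z hz) x hx (by
        rw [Real.dist_eq, abs_of_nonneg (by linarith [hz.1])]; linarith [hz.2])
      rw [Real.dist_eq] at this
      rw [Real.norm_eq_abs, one_mul]
      exact this.le)
    (left_mem_Icc.2 hxy) (right_mem_Icc.2 hxy)
  rw [Real.norm_eq_abs, Real.norm_eq_abs, abs_of_nonneg (sub_nonneg.2 hxy)] at h1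
  convert h1 using 2
  ring

lemma CouplingLe.mono {μ ν : Measure (Eucl n)} {c c' : ℝ} (h : CouplingLe μ ν c) (hc : c ≤ c') :
    CouplingLe μ ν c' := by
  obtain ⟨ρ, h1, h2, h3⟩ := h
  exact ⟨ρ, h1, h2, h3.trans hc⟩

lemma CouplingLe.refl (μ : Measure (Eucl n)) [IsProbabilityMeasure μ] : CouplingLe μ μ 0 := by
  have hd : Measurable fun x : Eucl n => (x, x) := by fun_prop
  refine ⟨μ.map fun x => (x, x), ⟨Measure.isProbabilityMeasure_map hd.aemeasurable, ?_, ?_⟩, ?_, ?_⟩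
  · rw [Measure.map_map measurable_fst hd]; exact Measure.map_id
  · rw [Measure.map_map measurable_snd hd]; exact Measure.map_id
  · rw [memLp_map_measure_iff (by fun_prop) hd.aemeasurable]
    simp [Function.comp_def]
  · rw [integral_map hd.aemeasurable (by fun_prop)]
    simp

variable {π : Measure (Eucl n × Eucl n)} [IsProbabilityMeasure π]

lemma integral_normSq_vel_full_le (hm : SecondMoments π) {r c : ℝ} (hr : 0 < r) :
    ∫ ω, ‖vel r c ω‖ ^ 2 ∂(PG π) ≤ 2 * velSq π + c ^ 2 / (2 * r) * n := by
  have h1 := integrable_normSq_of_memLp_two (hm.memLp_vel)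
  have h2 := integrable_normSq_of_memLp_two (memLp_noise (π := π))
  have h := integral_mono (integrable_normSq_of_memLp_two (hm.memLp_vel_full r c))
    ((h1.const_mul 2).add (h2.const_mul (c ^ 2 / (2 * r)))) (fun ω => by
      have h4 : 0 ≤ ‖(ω.1.2 - ω.1.1) - (c / (2 * √r)) • ω.2‖ ^ 2 := by positivity
      have h5 : (c / (2 * √r)) ^ 2 = c ^ 2 / (4 * r) := by
        rw [div_pow, mul_pow, Real.sq_sqrt hr.le]; norm_num
      rw [norm_sub_sq_real, norm_smul, mul_pow, Real.norm_eq_abs, sq_abs, h5] at h4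
      simp only [Pi.add_apply, vel]
      rw [norm_add_sq_real, norm_smul, mul_pow, Real.norm_eq_abs, sq_abs, h5]
      have h6 : c ^ 2 / (2 * r) = 2 * (c ^ 2 / (4 * r)) := by field_simp; norm_num
      rw [h6]
      linarith)
  rwa [integral_add' (h1.const_mul 2) (h2.const_mul _), integral_const_mul, integral_const_mul,
    integral_normSq_vel, integral_normSq_noise] at h

lemma pt_add_smul_vel {s d r r₂ : ℝ} (hd : d ≠ 0) (hr : 0 < r) (ω : (Eucl n × Eucl n) × Eucl n) :
    pt s r ω + d • vel r (2 * √r * (√r₂ - √r) / d) ω = pt (s + d) r₂ ω := by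
  have hs := (Real.sqrt_pos.2 hr).ne'
  have h : d * (2 * √r * (√r₂ - √r) / d / (2 * √r)) = √r₂ - √r := by field_simp
  simp only [pt, vel, line, smul_add, smul_smul, h]
  module

lemma tendsto_add_one_div_self :
    Tendsto (fun N : ℕ => ((N : ℝ) + 1) / N) atTop (𝓝 1) := by
  have h : Tendsto (fun N : ℕ => 1 + 1 / (N : ℝ)) atTop (𝓝 (1 + 0)) :=
    tendsto_const_nhds.add tendsto_one_div_atTop_nhds_zero_nat
  rw [add_zero] at h
  refine h.congr' ?_
  filter_upwards [eventually_gt_atTop 0] with N hN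
  field_simp

lemma tendsto_harmonic_mean :
    Tendsto (fun N : ℕ => ((N : ℝ) + 1) / N * ((N : ℝ)⁻¹ * ∑ j ∈ Finset.range N, 1 / ((j : ℝ) + 2)))
      atTop (𝓝 0) := by
  have h1 : Tendsto (fun j : ℕ => 1 / ((j : ℝ) + 2)) atTop (𝓝 0) := by
    have := tendsto_one_div_add_atTop_nhds_zero_nat (𝕜 := ℝ)
    have h := (tendsto_add_atTop_iff_nat 1).2 this
    refine h.congr fun j => ?_
    push_cast
    ring
  have h2 := h1.cesaro
  simpa using tendsto_add_one_div_self.mul h2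

/-- Iterating the transport step along a subdivision of the unit interval. -/
lemma couplingLe_chain (hm : SecondMoments π) {R : ℝ → ℝ} (hpos : ∀ s, 0 < R s) {N : ℕ}
    (hN : 0 < N) {β : ℕ → ℝ} {M : ℝ}
    (hE : ∀ i < N, EnergyLe π (i / N) (R (i / N))
      (2 * √(R (i / N)) * (√(R (i / N + (N : ℝ)⁻¹)) - √(R (i / N))) / (N : ℝ)⁻¹) (β i))
    (hM : ∀ i < N, ∫ ω, ‖vel (R (i / N))
      (2 * √(R (i / N)) * (√(R (i / N + (N : ℝ)⁻¹)) - √(R (i / N))) / (N : ℝ)⁻¹) ω‖ ^ 2 ∂(PG π)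
        ≤ M) :
    ∀ i ≤ N, CouplingLe ((PG π).map (pt (i / N) (R (i / N)))) ((PG π).map (pt 0 (R 0)))
      ((i + 1) * ∑ j ∈ Finset.range i, ((N : ℝ)⁻¹ ^ 2 * β j + M * (N : ℝ)⁻¹ ^ 2 / (j + 2))) := by
  intro i
  induction i with
  | zero =>
    intro _
    have : IsProbabilityMeasure ((PG π).map (pt 0 (R 0))) :=
      Measure.isProbabilityMeasure_map (continuous_pt 0 (R 0)).measurable.aemeasurable
    simpa using CouplingLe.refl ((PG π).map (pt 0 (R 0)))
  | succ i ih =>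
    intro hi
    have hi' : i < N := hi
    have hd : (N : ℝ)⁻¹ ≠ 0 := by positivity
    have hs := (ih hi'.le).step (continuous_pt _ _).measurable (continuous_vel _ _).measurable
      (hm.memLp_vel_full _ _) (l := (N : ℝ) / (i + 1)) (d := (N : ℝ)⁻¹) (by positivity)
      (by positivity) (hE i hi')
    have e1 : (fun ω => pt (i / N) (R (i / N)) ω + (N : ℝ)⁻¹ • vel (R (i / N))
      (2 * √(R (i / N)) * (√(R (i / N + (N : ℝ)⁻¹)) - √(R (i / N))) / (N : ℝ)⁻¹) ω)
        = pt (n := n) (((i + 1 : ℕ) : ℝ) / N) (R (((i + 1 : ℕ) : ℝ) / N)) := by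
      have e2 : ((i + 1 : ℕ) : ℝ) / N = i / N + (N : ℝ)⁻¹ := by
        push_cast
        rw [add_div, one_div]
      funext ω
      rw [pt_add_smul_vel hd (hpos _), e2]
    rw [e1] at hs
    refine hs.mono ?_
    rw [Finset.sum_range_succ]
    set A := ∑ j ∈ Finset.range i, ((N : ℝ)⁻¹ ^ 2 * β j + M * (N : ℝ)⁻¹ ^ 2 / (j + 2)) with hA
    have hb := (hE i hi').nonneg
    have hMi := mul_le_mul_of_nonneg_left (hM i hi') (sq_nonneg (N : ℝ)⁻¹)
    have e3 : (N : ℝ)⁻¹ * (β i / (N / (i + 1)) + N / (i + 1) * ((i + 1) * A))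
        = (N : ℝ)⁻¹ ^ 2 * (i + 1) * β i + A := by
      field_simp
    have e4 : (((i + 1 : ℕ) : ℝ) + 1)
        * (A + ((N : ℝ)⁻¹ ^ 2 * β i + M * (N : ℝ)⁻¹ ^ 2 / (i + 2)))
        = (i + 2) * A + (i + 2) * ((N : ℝ)⁻¹ ^ 2 * β i) + (N : ℝ)⁻¹ ^ 2 * M := by
      push_cast
      field_simp
      ring
    rw [e3, e4]
    have : 0 ≤ (N : ℝ)⁻¹ ^ 2 * β i := by positivity
    linarith

/-- The quadratic transport cost between the end points is at most the integrated energy. -/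
theorem couplingLe_of_energyLe (hm : SecondMoments π) {R R' Ψ : ℝ → ℝ}
    (hR : ∀ s, HasDerivAt R (R' s) s) (hR' : Continuous R') (hpos : ∀ s, 0 < R s)
    (hΨ : Continuous Ψ) (hE : ∀ s ∈ Icc (0 : ℝ) 1, EnergyLe π s (R s) (R' s) (Ψ s))
    {η : ℝ} (hη : 0 < η) :
    CouplingLe ((PG π).map (pt 1 (R 1))) ((PG π).map (pt 0 (R 0)))
      ((∫ s in (0 : ℝ)..1, Ψ s) + 3 * η) := by
  have hRc : Continuous R := continuous_iff_continuousAt.2 fun s => (hR s).continuousAt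
  have hRi : Continuous fun s => (R s)⁻¹ := hRc.inv₀ fun s => (hpos s).ne'
  have hRs : Continuous fun s => √(R s) := hRc.sqrt
  obtain ⟨A, hA⟩ := isCompact_Icc.exists_bound_of_continuousOn (s := Icc (0 : ℝ) 1) hR'.continuousOn
  obtain ⟨B, hB⟩ := isCompact_Icc.exists_bound_of_continuousOn (s := Icc (0 : ℝ) 1) hRi.continuousOn
  obtain ⟨D, hD⟩ := isCompact_Icc.exists_bound_of_continuousOn (s := Icc (0 : ℝ) 1) hRs.continuousOn
  simp only [Real.norm_eq_abs] at hA hB hD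
  have h0 : (0 : ℝ) ∈ Icc (0 : ℝ) 1 := by simp
  have hA0 : 0 ≤ A := (abs_nonneg _).trans (hA 0 h0)
  have hB0 : 0 ≤ B := (abs_nonneg _).trans (hB 0 h0)
  have hD0 : 0 ≤ D := (abs_nonneg _).trans (hD 0 h0)
  have hC0 := velSq_nonneg π
  set F := n * B with hF
  have hF0 : 0 ≤ F := by positivity
  set S := (velSq π + F) / 2 + A / 2 * F with hS
  have hS0 : 0 ≤ S := by positivity
  have hnR : ∀ s ∈ Icc (0 : ℝ) 1, n / R s ≤ F := fun s hs => by
    rw [div_eq_mul_inv]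
    exact mul_le_mul_of_nonneg_left ((le_abs_self _).trans (hB s hs)) (by positivity)
  have hslope : ∀ s ∈ Icc (0 : ℝ) 1, |slope π s (R s) (R' s)| ≤ S := fun s hs => by
    refine (abs_slope_le hm (hpos s) s (R' s)).trans ?_
    have h1 := hnR s hs
    have h2 := hA s hs
    have h3 : 0 ≤ n / R s := div_nonneg (by positivity) (hpos s).le
    rw [hS]
    gcongr
  obtain ⟨w, hw0, hw1, hw2⟩ : ∃ w : ℝ, 0 < w ∧ w ≤ 1 ∧ w * (S + F) ≤ η := by
    refine ⟨min 1 (η / (S + F + 1)), by positivity, min_le_left _ _, ?_⟩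
    have h1 : min 1 (η / (S + F + 1)) ≤ η / (S + F + 1) := min_le_right _ _
    have h2 : 0 ≤ S + F := by positivity
    calc min 1 (η / (S + F + 1)) * (S + F) ≤ η / (S + F + 1) * (S + F + 1) :=
          mul_le_mul h1 (by linarith) h2 (by positivity)
      _ = η := by field_simp
  have hq : ∀ s ∈ Icc (0 : ℝ) 1, HasDerivAt (fun s => √(R s)) (R' s / (2 * √(R s))) s :=
    fun s _ => (hR s).sqrt (hpos s).ne'
  have hq' : ContinuousOn (fun s => R' s / (2 * √(R s))) (Icc (0 : ℝ) 1) :=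
    (hR'.div (by fun_prop) fun s => by have := Real.sqrt_pos.2 (hpos s); positivity).continuousOn
  obtain ⟨δ₁, hδ₁, hT₁⟩ := exists_taylor_bound (η := w / (2 * (D + 1))) (by positivity) hq hq'
  obtain ⟨δ₂, hδ₂, hT₂⟩ := exists_taylor_bound (a := 0) (b := 1) hη
    (fun s _ => intervalIntegral.integral_hasDerivAt_right (hΨ.intervalIntegrable 0 s)
      hΨ.stronglyMeasurable.stronglyMeasurableAtFilter hΨ.continuousAt) hΨ.continuousOn
  set M := 2 * velSq π + (A + 1) ^ 2 / 2 * F with hM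
  set I := ∫ s in (0 : ℝ)..1, Ψ s with hI
  have hlim : Tendsto (fun N : ℕ => ((N : ℝ) + 1) / N * (I + 2 * η) + M * (((N : ℝ) + 1) / N *
      ((N : ℝ)⁻¹ * ∑ j ∈ Finset.range N, 1 / ((j : ℝ) + 2)))) atTop (𝓝 (I + 2 * η)) := by
    simpa using (tendsto_add_one_div_self.mul_const (I + 2 * η)).add
      (tendsto_harmonic_mean.const_mul M)
  have hinv : Tendsto (fun N : ℕ => ((N : ℝ)⁻¹)) atTop (𝓝 0) := tendsto_inv_atTop_nhds_zero_nat
  obtain ⟨N, hN1, hN2, hN3, hN⟩ := ((hlim.eventually_lt_const (show I + 2 * η < I + 3 * η by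
    linarith)).and ((hinv.eventually_lt_const hδ₁).and ((hinv.eventually_lt_const hδ₂).and
      (eventually_gt_atTop 0)))).exists
  have hNpos : (0 : ℝ) < N := by exact_mod_cast hN
  have hmem : ∀ i < N, (i / N : ℝ) ∈ Icc (0 : ℝ) 1 ∧ (i / N + (N : ℝ)⁻¹ : ℝ) ∈ Icc (0 : ℝ) 1 := by
    intro i hi
    have h1 : (i : ℝ) + 1 ≤ N := by exact_mod_cast hi
    have h2 : (i / N + (N : ℝ)⁻¹ : ℝ) ≤ 1 := by
      rw [← one_div, ← add_div, div_le_one hNpos]; exact h1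
    have h3 : 0 ≤ (N : ℝ)⁻¹ := by positivity
    refine ⟨⟨by positivity, by linarith⟩, ⟨by positivity, h2⟩⟩
  have hrate : ∀ i < N, |2 * √(R (i / N)) * (√(R (i / N + (N : ℝ)⁻¹)) - √(R (i / N))) / (N : ℝ)⁻¹
      - R' (i / N)| ≤ w := by
    intro i hi
    obtain ⟨m1, m2⟩ := hmem i hi
    have hinvp : 0 < (N : ℝ)⁻¹ := by positivity
    have h := hT₁ _ m1 _ m2 (by linarith) (by simpa using hN2)
    have hsq := Real.sqrt_pos.2 (hpos (i / N))
    simp only [add_sub_cancel_left] at h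
    have e : 2 * √(R (i / N)) * (√(R (i / N + (N : ℝ)⁻¹)) - √(R (i / N))) / (N : ℝ)⁻¹ - R' (i / N)
        = 2 * √(R (i / N)) * N * (√(R (i / N + (N : ℝ)⁻¹)) - √(R (i / N))
          - (N : ℝ)⁻¹ * (R' (i / N) / (2 * √(R (i / N))))) := by
      field_simp
    rw [e, abs_mul, abs_of_pos (by positivity : 0 < 2 * √(R (i / N)) * N)]
    have hDi : √(R (i / N)) ≤ D + 1 := ((le_abs_self _).trans (hD _ m1)).trans (by linarith)
    calc 2 * √(R (i / N)) * N * _ ≤ 2 * (D + 1) * N * (w / (2 * (D + 1)) * (N : ℝ)⁻¹) := by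
          gcongr
      _ = w := by field_simp
  have hchain := couplingLe_chain hm hpos hN (β := fun i => Ψ (i / N) + η) (M := M)
    (fun i hi => by
      obtain ⟨m1, m2⟩ := hmem i hi
      set c := 2 * √(R (i / N)) * (√(R (i / N + (N : ℝ)⁻¹)) - √(R (i / N))) / (N : ℝ)⁻¹ with hc
      have h1 := (hE _ m1).add_rate hm (hpos _) (c - R' (i / N))
      rw [add_sub_cancel] at h1
      refine h1.mono ?_
      have h2 := hrate i hi
      have h3 := hslope _ m1
      have h4 : (c - R' (i / N)) * slope π (i / N) (R (i / N)) (R' (i / N)) ≤ w * S := by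
        refine (le_abs_self _).trans ?_
        rw [abs_mul]
        gcongr
      have h5 : (c - R' (i / N)) ^ 2 ≤ w := by
        rw [← sq_abs]
        have := abs_nonneg (c - R' (i / N))
        nlinarith
      have h6 := (fisher_le hm (hpos (i / N)) (i / N)).trans (hnR _ m1)
      have h7 : (c - R' (i / N)) ^ 2 / 4 * fisher π (i / N) (R (i / N)) ≤ w * F := by
        have := fisher_nonneg π (i / N) (R (i / N))
        have : (c - R' (i / N)) ^ 2 / 4 ≤ w := by linarith
        gcongr
      linarith)
    (fun i hi => by
      obtain ⟨m1, m2⟩ := hmem i hi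
      refine (integral_normSq_vel_full_le hm (hpos _)).trans ?_
      have h2 := hrate i hi
      set c := 2 * √(R (i / N)) * (√(R (i / N + (N : ℝ)⁻¹)) - √(R (i / N))) / (N : ℝ)⁻¹ with hc
      have h3 : |c| ≤ A + 1 := by
        have h4 := abs_sub_abs_le_abs_sub c (R' (i / N))
        have h5 := hA _ m1
        linarith
      have h6 : c ^ 2 ≤ (A + 1) ^ 2 := by
        rw [← sq_abs]
        gcongr
      have h7 := hnR _ m1
      have h8 : c ^ 2 / (2 * R (i / N)) * n = c ^ 2 / 2 * (n / R (i / N)) := by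
        have := (hpos (i / N)).ne'
        field_simp
      have h9 : 0 ≤ n / R (i / N) := div_nonneg (by positivity) (hpos _).le
      rw [h8, hM]
      gcongr)
    N le_rfl
  rw [div_self hNpos.ne'] at hchain
  refine hchain.mono (le_trans (le_of_eq ?_) ((add_le_add_left (mul_le_mul_of_nonneg_left
    (a := ((N : ℝ) + 1) / N) (b := (N : ℝ)⁻¹ * ∑ j ∈ Finset.range N, (Ψ (j / N) + η)) ?_
      (by positivity)) _).trans hN1.le))
  · simp only [Finset.sum_add_distrib, ← Finset.mul_sum, Finset.sum_const,
      Finset.card_range, nsmul_eq_mul, ← Finset.mul_sum, div_eq_mul_inv, one_mul]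
    field_simp
  · have htel := Finset.sum_range_sub (fun i : ℕ => ∫ s in (0 : ℝ)..(i / N : ℝ), Ψ s) N
    rw [div_self hNpos.ne', Nat.cast_zero, zero_div, intervalIntegral.integral_same, sub_zero,
      ← hI] at htel
    rw [← htel, ← sub_le_iff_le_add]
    have e : (N : ℝ)⁻¹ * ∑ j ∈ Finset.range N, (Ψ (j / N) + η) - 2 * η
        = ∑ j ∈ Finset.range N, (N : ℝ)⁻¹ * (Ψ (j / N) - η) := by
      simp only [mul_add, mul_sub, Finset.sum_add_distrib, Finset.sum_sub_distrib,
        ← Finset.mul_sum, Finset.sum_const, Finset.card_range, nsmul_eq_mul]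
      field_simp
      ring
    rw [e]
    refine Finset.sum_le_sum fun i hi => ?_
    obtain ⟨m1, m2⟩ := hmem i (Finset.mem_range.1 hi)
    have hinvp : 0 < (N : ℝ)⁻¹ := by positivity
    have h := (abs_le.1 (hT₂ _ m1 _ m2 (by linarith) (by simpa using hN3))).1
    have e2 : ((i + 1 : ℕ) : ℝ) / N = i / N + (N : ℝ)⁻¹ := by
      push_cast
      rw [add_div, one_div]
    rw [e2]
    simp only [add_sub_cancel_left] at h
    linarith

end

section

/-- The identity up to `a`, continued as a bounded increasing function with slope
`m² / (m + y)²` at `a + y`. -/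
def flatten (a m p : ℝ) : ℝ := p - max (p - a) 0 ^ 2 / (m + max (p - a) 0)

/-- The derivative of `flatten`. -/
def flattenDeriv (a m p : ℝ) : ℝ := (m / (m + max (p - a) 0)) ^ 2

lemma continuous_flattenDeriv {a m : ℝ} (hm : 0 < m) : Continuous (flattenDeriv a m) := by
  have h : ∀ p, m + max (p - a) 0 ≠ 0 := fun p => by
    have := le_max_right (p - a) 0
    positivity
  exact (continuous_const.div (by fun_prop) h).pow 2

lemma continuous_flatten {a m : ℝ} (hm : 0 < m) : Continuous (flatten a m) := by
  have h : ∀ p, m + max (p - a) 0 ≠ 0 := fun p => by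
    have := le_max_right (p - a) 0
    positivity
  exact continuous_id.sub (Continuous.div (by fun_prop) (by fun_prop) h)

lemma flatten_of_le {a m p : ℝ} (hp : p ≤ a) : flatten a m p = p := by
  simp [flatten, max_eq_right (sub_nonpos.2 hp)]

lemma flattenDeriv_of_le {a m p : ℝ} (hm : 0 < m) (hp : p ≤ a) : flattenDeriv a m p = 1 := by
  simp [flattenDeriv, max_eq_right (sub_nonpos.2 hp), hm.ne']

lemma hasDerivAt_flatten {a m : ℝ} (hm : 0 < m) (p : ℝ) :
    HasDerivAt (flatten a m) (flattenDeriv a m p) p := by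
  have hne : ∀ q ≠ a, HasDerivAt (flatten a m) (flattenDeriv a m q) q := by
    intro q hq
    rcases hq.lt_or_gt with h | h
    · rw [flattenDeriv_of_le hm h.le]
      refine (hasDerivAt_id q).congr_of_eventuallyEq ?_
      filter_upwards [eventually_lt_nhds h] with x hx using flatten_of_le hx.le
    · have hpos : 0 < q - a := sub_pos.2 h
      have h1 : HasDerivAt (fun x : ℝ => x - (x - a) ^ 2 / (m + (x - a)))
          (flattenDeriv a m q) q := by
        have e1 : HasDerivAt (fun x : ℝ => x - a) 1 q := (hasDerivAt_id q).sub_const a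
        have e2 := (hasDerivAt_id q).sub ((e1.pow 2).div (e1.const_add m) (by positivity))
        refine e2.congr_deriv ?_
        rw [flattenDeriv, max_eq_left hpos.le]
        field_simp
        norm_num
        ring
      refine h1.congr_of_eventuallyEq ?_
      filter_upwards [eventually_gt_nhds h] with x hx
      rw [flatten, max_eq_left (sub_nonneg.2 hx.le)]
  by_cases hp : p = a
  · subst hp
    exact hasDerivAt_of_hasDerivAt_of_ne hne (continuous_flatten hm).continuousAt
      (continuous_flattenDeriv hm).continuousAt
  · exact hne p hp

lemma flattenDeriv_nonneg (a m p : ℝ) : 0 ≤ flattenDeriv a m p := sq_nonneg _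

lemma flattenDeriv_le_one {a m : ℝ} (hm : 0 < m) (p : ℝ) : flattenDeriv a m p ≤ 1 := by
  have := le_max_right (p - a) 0
  have h : m / (m + max (p - a) 0) ≤ 1 := (div_le_one (by positivity)).2 (by linarith)
  have h0 : 0 ≤ m / (m + max (p - a) 0) := by positivity
  exact pow_le_one₀ h0 h

/-- A rate function of the exponential entropy power, normalized at both end points. -/
lemma exists_rate {p₀ p₁ l u : ℝ} (hl : 0 < l) (h₀ : p₀ ∈ Icc l u) (h₁ : p₁ ∈ Icc l u) :
    ∃ Θ Θ' φ φ' : ℝ → ℝ, (∀ p, HasDerivAt Θ (Θ' p) p) ∧ Continuous Θ' ∧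
      (∀ p, HasDerivAt φ (φ' p) p) ∧ Continuous φ' ∧ Θ p₀ = 1 ∧ Θ p₁ = 1 ∧ φ p₀ = p₀ ∧ φ p₁ = p₁ ∧
      (∀ p, 0 ≤ φ' p) ∧ (∀ p, φ' p ≤ 1) ∧ (∀ p, 0 < p → 0 ≤ Θ p) ∧
      (∀ p, 0 < p → Θ p ≤ 2 * (u / l) ^ 2) ∧ (∀ p, 0 < p → |Θ' p * p| ≤ 2 * (u / l) ^ 2) ∧
      ∀ p, p₀ * p₁ * (Θ' p * p - Θ p) = -(p ^ 2 * φ' p) := by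
  wlog h : p₁ ≤ p₀ generalizing p₀ p₁
  · obtain ⟨Θ, Θ', φ, φ', a1, a2, a3, a4, a5, a6, a7, a8, a9, a10, a11, a12, a13, a14⟩ :=
      this h₁ h₀ (le_of_not_ge h)
    exact ⟨Θ, Θ', φ, φ', a1, a2, a3, a4, a6, a5, a8, a7, a9, a10, a11, a12, a13,
      fun p => by rw [mul_comm p₀ p₁, a14]⟩
  have hp₀ : 0 < p₀ := hl.trans_le h₀.1
  have hp₁ : 0 < p₁ := hl.trans_le h₁.1
  have hu : 0 < u := hp₀.trans_le h₀.2
  set φ := flatten p₀ p₁ with hφ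
  set φ' := flattenDeriv p₀ p₁ with hφ'
  set Θ : ℝ → ℝ := fun p => p * (p₀ + p₁ - φ p) / (p₀ * p₁) with hΘ
  set Θ' : ℝ → ℝ := fun p => (p₀ + p₁ - φ p - p * φ' p) / (p₀ * p₁) with hΘ'
  have key : ∀ p, p₀ * p₁ * (Θ' p * p - Θ p) = -(p ^ 2 * φ' p) := by
    intro p
    simp only [hΘ, hΘ']
    field_simp
    ring
  have hfl : ∀ p, p₀ < p → p₀ + p₁ - φ p = p₁ ^ 2 / (p₁ + (p - p₀)) := by
    intro p hp
    have := sub_pos.2 hp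
    rw [hφ, flatten, max_eq_left this.le]
    field_simp
    ring
  have hΘ0 : ∀ p, 0 < p → 0 ≤ Θ p := by
    intro p hp
    refine div_nonneg (mul_nonneg hp.le ?_) (by positivity)
    rcases le_or_gt p p₀ with hpp | hpp
    · rw [hφ, flatten_of_le hpp]; linarith
    · have := sub_pos.2 hpp
      rw [hfl p hpp]; positivity
  have hul : 1 ≤ u / l := (one_le_div hl).2 (h₀.1.trans h₀.2)
  have hden : l ^ 2 ≤ p₀ * p₁ := by rw [sq]; exact mul_le_mul h₀.1 h₁.1 hl.le hp₀.le
  have hΘ1 : ∀ p, 0 < p → Θ p ≤ (u / l) ^ 2 := by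
    intro p hp
    rcases le_or_gt p p₀ with hpp | hpp
    · simp only [hΘ]
      rw [hφ, flatten_of_le hpp, div_pow]
      have h2 : p * (p₀ + p₁ - p) ≤ u ^ 2 := by
        have h3 : (p₀ + p₁) ^ 2 ≤ (2 * u) ^ 2 := by
          have := h₀.2; have := h₁.2; gcongr; linarith
        nlinarith [sq_nonneg (p₀ + p₁ - 2 * p)]
      gcongr
    · have hy := sub_pos.2 hpp
      have h2 : Θ p ≤ 1 := by
        simp only [hΘ]
        rw [hfl p hpp, div_le_one (by positivity), mul_div_assoc', div_le_iff₀ (by positivity)]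
        nlinarith [mul_nonneg (mul_nonneg hp₁.le hy.le) (sub_nonneg.2 h)]
      nlinarith
  have hpφ : ∀ p, 0 < p → p ^ 2 * φ' p ≤ u ^ 2 := by
    intro p hp
    rcases le_or_gt p p₀ with hpp | hpp
    · rw [hφ', flattenDeriv_of_le hp₁ hpp, mul_one]
      have := h₀.2
      gcongr
      linarith
    · have hy := sub_pos.2 hpp
      rw [hφ', flattenDeriv, max_eq_left hy.le, ← mul_pow]
      have h0 : 0 ≤ p * (p₁ / (p₁ + (p - p₀))) := by positivity
      refine pow_le_pow_left₀ h0 (le_trans ?_ h₀.2) 2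
      rw [mul_div_assoc', div_le_iff₀ (by positivity)]
      nlinarith [mul_nonneg hy.le (sub_nonneg.2 h)]
  refine ⟨Θ, Θ', φ, φ', fun p => ?_, ?_, hasDerivAt_flatten hp₁, continuous_flattenDeriv hp₁,
    ?_, ?_, flatten_of_le le_rfl, flatten_of_le h, flattenDeriv_nonneg _ _,
    flattenDeriv_le_one hp₁, hΘ0, fun p hp => (hΘ1 p hp).trans ?_, fun p hp => ?_, key⟩
  · have h1 := ((hasDerivAt_id p).mul ((hasDerivAt_flatten (a := p₀) hp₁ p).const_sub
      (p₀ + p₁))).div_const (p₀ * p₁)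
    refine h1.congr_deriv ?_
    simp only [hΘ', id]
    ring
  · have h1 := continuous_flatten (a := p₀) hp₁
    have h2 := continuous_flattenDeriv (a := p₀) hp₁
    simp only [hΘ', hφ, hφ']
    fun_prop
  · simp only [hΘ]
    rw [hφ, flatten_of_le le_rfl]
    field_simp
    ring
  · simp only [hΘ]
    rw [hφ, flatten_of_le h]
    field_simp
    ring
  · nlinarith [sq_nonneg (u / l)]
  · have h1 : Θ' p * p = Θ p - p ^ 2 * φ' p / (p₀ * p₁) := by
      have := key p
      field_simp
      linarith
    have h2 : p ^ 2 * φ' p / (p₀ * p₁) ≤ (u / l) ^ 2 := by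
      have := hpφ p hp
      rw [div_pow]
      gcongr
    have h3 : 0 ≤ p ^ 2 * φ' p / (p₀ * p₁) := by
      have := flattenDeriv_nonneg p₀ p₁ p
      positivity
    rw [h1, abs_le]
    constructor <;> linarith [hΘ0 p hp, hΘ1 p hp]

lemma sq_integral_le_integral_sq {w : ℝ → ℝ} (hw : Continuous w) :
    (∫ s in (0 : ℝ)..1, w s) ^ 2 ≤ ∫ s in (0 : ℝ)..1, w s ^ 2 := by
  set m := ∫ s in (0 : ℝ)..1, w s with hm
  have h := intervalIntegral.integral_nonneg (μ := volume) zero_le_one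
    (fun s (_ : s ∈ Icc (0 : ℝ) 1) => sq_nonneg (w s - m))
  have e : ∀ s, (w s - m) ^ 2 = w s ^ 2 - 2 * m * w s + m ^ 2 := fun s => by ring
  have i1 : IntervalIntegrable (fun s => w s ^ 2) volume 0 1 := (hw.pow 2).intervalIntegrable _ _
  have i2 : IntervalIntegrable (fun s => 2 * m * w s) volume 0 1 :=
    (hw.const_mul _).intervalIntegrable _ _
  simp_rw [e] at h
  rw [intervalIntegral.integral_add (i1.sub i2) (by simp), intervalIntegral.integral_sub i1 i2,
    intervalIntegral.integral_const_mul, ← hm] at h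
  simp at h
  nlinarith

lemma exp_sub_sq_div (x y : ℝ) {N : ℝ} (hN : N ≠ 0) :
    (Real.exp (y / N) - Real.exp (x / N)) ^ 2 / (Real.exp (x / N) * Real.exp (y / N))
      = 4 * Real.sinh ((x - y) / (2 * N)) ^ 2 := by
  set a := Real.exp (x / (2 * N)) with ha
  set b := Real.exp (y / (2 * N)) with hb
  have hx : Real.exp (x / N) = a ^ 2 := by
    rw [ha, ← Real.exp_nat_mul]; congr 1; push_cast; field_simp
  have hy : Real.exp (y / N) = b ^ 2 := by
    rw [hb, ← Real.exp_nat_mul]; congr 1; push_cast; field_simp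
  have ha0 : a ≠ 0 := (Real.exp_pos _).ne'
  have hb0 : b ≠ 0 := (Real.exp_pos _).ne'
  have h1 : Real.exp ((x - y) / (2 * N)) = a / b := by rw [sub_div, Real.exp_sub]
  have h2 : Real.exp (-((x - y) / (2 * N))) = b / a := by rw [sub_div, neg_sub, Real.exp_sub]
  rw [Real.sinh_eq, h1, h2, hx, hy]
  field_simp
  ring

end

section

variable {n : ℕ} {π : Measure (Eucl n × Eucl n)}

/-- A variance profile `R ≥ ε`, equal to `t` at both ends, along which the interpolation has an
energy bounded by `Ψ`. -/
structure IsProfile (π : Measure (Eucl n × Eucl n)) (ε t : ℝ) (R R' Ψ : ℝ → ℝ) : Prop where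
  hasDerivAt : ∀ s, HasDerivAt R (R' s) s
  continuous_deriv : Continuous R'
  le : ∀ s, ε ≤ R s
  left : R 0 = t
  right : R 1 = t
  continuous_energy : Continuous Ψ
  energyLe : ∀ s ∈ Icc (0 : ℝ) 1, EnergyLe π s (R s) (R' s) (Ψ s)

lemma IsProfile.continuous {ε t : ℝ} {R R' Ψ : ℝ → ℝ} (h : IsProfile π ε t R R' Ψ) :
    Continuous R := continuous_iff_continuousAt.2 fun s => (h.hasDerivAt s).continuousAt

variable [IsProbabilityMeasure π]

lemma isProfile_const (hm : SecondMoments π) (ε : ℝ) :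
    IsProfile π ε ε (fun _ => ε) (fun _ => 0) (fun _ => velSq π) where
  hasDerivAt s := hasDerivAt_const s ε
  continuous_deriv := continuous_const
  le _ := le_rfl
  left := rfl
  right := rfl
  continuous_energy := continuous_const
  energyLe s _ := energyLe_velSq hm s ε

lemma continuous_slope_comp (hm : SecondMoments π) {R C : ℝ → ℝ} (hR : Continuous R)
    (hC : Continuous C) (hpos : ∀ s, 0 < R s) : Continuous fun s => slope π s (R s) (C s) := by
  refine continuous_iff_continuousAt.2 fun s => ?_
  have h := continuousAt_slope hm (hpos s) s (C s)
  have h' : ContinuousAt (fun s : ℝ => ((s, R s, C s) : ℝ × ℝ × ℝ)) s := by fun_prop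
  exact ContinuousAt.comp (f := fun s : ℝ => ((s, R s, C s) : ℝ × ℝ × ℝ)) h h'

lemma abs_slope_le_of_le (hm : SecondMoments π) {ε r : ℝ} (hε : 0 < ε) (hr : ε ≤ r) (s c : ℝ) :
    |slope π s r c| ≤ (velSq π + n / ε) * (1 + |c|) := by
  have h := abs_slope_le hm (hε.trans_le hr) s c
  have h1 : (n : ℝ) / r ≤ n / ε := by gcongr
  have h2 : 0 ≤ (n : ℝ) / r := div_nonneg n.cast_nonneg (hε.le.trans hr)
  have h3 := velSq_nonneg π
  have h4 := abs_nonneg c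
  nlinarith [mul_nonneg h4 h3, mul_le_mul_of_nonneg_left h1 h4, mul_nonneg h4 h2]

/-- The dissipation rate `4 n sinh² ((H₀ - H₁) / (2 n))` of the heat flow. -/
def dissip (π : Measure (Eucl n × Eucl n)) (t : ℝ) : ℝ :=
  4 * n * Real.sinh ((ent π 0 t - ent π 1 t) / (2 * n)) ^ 2

lemma integral_rate_le (hm : SecondMoments π) (hn : 1 ≤ n) {R R' : ℝ → ℝ} {t : ℝ}
    (hR : ∀ s, HasDerivAt R (R' s) s) (hR' : Continuous R') (hpos : ∀ s, 0 < R s)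
    (h0 : R 0 = t) (h1 : R 1 = t) {φ φ' : ℝ → ℝ} (hφ : ∀ p, HasDerivAt φ (φ' p) p)
    (hφ' : Continuous φ') (hφ0 : φ (Real.exp (ent π 0 t / n)) = Real.exp (ent π 0 t / n))
    (hφ1 : φ (Real.exp (ent π 1 t / n)) = Real.exp (ent π 1 t / n))
    (hφn : ∀ p, 0 ≤ φ' p) (hφl : ∀ p, φ' p ≤ 1) :
    dissip π t ≤ ∫ s in (0 : ℝ)..1,
      Real.exp (ent π s (R s) / n) ^ 2 * φ' (Real.exp (ent π s (R s) / n)) * slope π s (R s) (R' s) ^ 2 / n / (Real.exp (ent π 0 t / n) * Real.exp (ent π 1 t / n)) := by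
  have hn0 : (n : ℝ) ≠ 0 := by positivity
  have hn1 : (1 : ℝ) ≤ n := by exact_mod_cast hn
  have hcR : Continuous R := continuous_iff_continuousAt.2 fun s => (hR s).continuousAt
  set p : ℝ → ℝ := fun s => Real.exp (ent π s (R s) / n) with hp
  set S : ℝ → ℝ := fun s => slope π s (R s) (R' s) with hS
  have hcS : Continuous S := continuous_slope_comp hm hcR hR' hpos
  have hpd : ∀ s, HasDerivAt p (p s * (S s / n)) s := fun s =>
    ((hasDerivAt_ent hm (hR s) (hpos s)).div_const n).exp
  have hcp : Continuous p := continuous_iff_continuousAt.2 fun s => (hpd s).continuousAt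
  have hp0 : Real.exp (ent π 0 t / n) = p 0 := by simp only [hp, h0]
  have hp1 : Real.exp (ent π 1 t / n) = p 1 := by simp only [hp, h1]
  rw [hp0] at hφ0
  rw [hp1] at hφ1
  set w : ℝ → ℝ := fun s => φ' (p s) * (p s * (S s / n)) with hw
  have hcw : Continuous w := by fun_prop
  have hftc : ∫ s in (0 : ℝ)..1, w s = p 1 - p 0 := by
    have := intervalIntegral.integral_eq_sub_of_hasDerivAt (a := 0) (b := 1)
      (f := fun s => φ (p s)) (f' := w) (fun s _ => (hφ (p s)).comp s (hpd s))
      (hcw.intervalIntegrable _ _)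
    simpa only [hφ0, hφ1] using this
  have hsq := sq_integral_le_integral_sq hcw
  have hpp : 0 < p 0 * p 1 := mul_pos (Real.exp_pos _) (Real.exp_pos _)
  have hd : dissip π t = (n / (p 0 * p 1)) * ((p 1 - p 0) ^ 2) := by
    have := exp_sub_sq_div (ent π 0 t) (ent π 1 t) hn0
    rw [hp0, hp1] at this
    rw [dissip, mul_comm (4 : ℝ), mul_assoc, ← this]
    ring
  rw [hd, ← hftc, hp0, hp1]
  calc n / (p 0 * p 1) * (∫ s in (0 : ℝ)..1, w s) ^ 2
      ≤ n / (p 0 * p 1) * ∫ s in (0 : ℝ)..1, w s ^ 2 := by gcongr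
    _ = ∫ s in (0 : ℝ)..1, n / (p 0 * p 1) * w s ^ 2 := by
        rw [intervalIntegral.integral_const_mul]
    _ ≤ _ := by
        refine intervalIntegral.integral_mono_on zero_le_one
          ((by fun_prop : Continuous fun s => n / (p 0 * p 1) * w s ^ 2).intervalIntegrable _ _)
          ((by fun_prop : Continuous fun s => p s ^ 2 * φ' (p s) * S s ^ 2 / n /
            (p 0 * p 1)).intervalIntegrable _ _) fun s _ => ?_
        have e1 : n / (p 0 * p 1) * w s ^ 2
          = (p s ^ 2 * φ' (p s) * S s ^ 2 / n / (p 0 * p 1)) * φ' (p s) := by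
          simp only [hw]; field_simp
        have e2 : 0 ≤ p s ^ 2 * φ' (p s) * S s ^ 2 / n / (p 0 * p 1) := by
          have := hφn (p s); positivity
        rw [e1]
        exact mul_le_of_le_one_right e2 (hφl _)

lemma IsProfile.step (hm : SecondMoments π) (hn : 1 ≤ n) {ε t l u h Λ : ℝ} (hε : 0 < ε)
    (hl : 0 < l) (h₀ : Real.exp (ent π 0 t / n) ∈ Icc l u) (h₁ : Real.exp (ent π 1 t / n) ∈ Icc l u)
    (hh : 0 ≤ h) {R R' Ψ : ℝ → ℝ} (H : IsProfile π ε t R R' Ψ) (hΛ : ∀ s, 1 + |R' s| ≤ Λ) :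
    ∃ R₂ R₂' Ψ₂ : ℝ → ℝ, IsProfile π ε (t + h) R₂ R₂' Ψ₂ ∧
      (∀ s, R s ≤ R₂ s ∧ R₂ s ≤ R s + h * (2 * (u / l) ^ 2)) ∧
      (∀ s, 1 + |R₂' s| ≤ (1 + h * (2 * (u / l) ^ 2 * (velSq π + n / ε))) * Λ) ∧
      ∀ ω, (∀ s ∈ Icc (0 : ℝ) 1, |slope π s (R₂ s) (R' s) - slope π s (R s) (R' s)| ≤ ω) →
        ∫ s in (0 : ℝ)..1, Ψ₂ s ≤ (∫ s in (0 : ℝ)..1, Ψ s) - h * dissip π t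
          + h * (3 * (2 * (u / l) ^ 2 * (velSq π + n / ε) * Λ) * ω
            + h * ((2 * (u / l) ^ 2 * (velSq π + n / ε) * Λ) ^ 2 / 4 * (n / ε))) := by
  have hn0 : (n : ℝ) ≠ 0 := by positivity
  have hn1 : (1 : ℝ) ≤ n := by exact_mod_cast hn
  obtain ⟨Θ, Θ', φ, φ', hΘ, hΘc, hφ, hφc, hΘ0, hΘ1, hφ0, hφ1, hφn, hφl, hΘn, hΘB, hΘ'B, hid⟩ :=
    exists_rate hl h₀ h₁
  set B := 2 * (u / l) ^ 2 with hB
  have hB0 : 0 ≤ B := by positivity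
  set a := velSq π + n / ε with ha
  have ha0 : 0 ≤ a := add_nonneg (velSq_nonneg π) (by positivity)
  have hpos : ∀ s, 0 < R s := fun s => hε.trans_le (H.le s)
  have hcR := H.continuous
  have hcR' := H.continuous_deriv
  have hΛ0 : 0 ≤ Λ := le_trans (by positivity) (hΛ 0)
  have hint := integral_rate_le hm hn H.hasDerivAt hcR' hpos H.left H.right hφ hφc hφ0 hφ1 hφn hφl
  set p₀ := Real.exp (ent π 0 t / n) with hp₀
  set p₁ := Real.exp (ent π 1 t / n) with hp₁
  have hpp : 0 < p₀ * p₁ := mul_pos (Real.exp_pos _) (Real.exp_pos _)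
  set p : ℝ → ℝ := fun s => Real.exp (ent π s (R s) / n) with hp
  set S : ℝ → ℝ := fun s => slope π s (R s) (R' s) with hS
  have hp0 : ∀ s, 0 < p s := fun s => Real.exp_pos _
  have hcS : Continuous S := continuous_slope_comp hm hcR hcR' hpos
  have hpd : ∀ s, HasDerivAt p (p s * (S s / n)) s := fun s =>
    ((hasDerivAt_ent hm (H.hasDerivAt s) (hpos s)).div_const n).exp
  have hcp : Continuous p := continuous_iff_continuousAt.2 fun s => (hpd s).continuousAt
  have hcΘ : Continuous Θ := continuous_iff_continuousAt.2 fun s => (hΘ s).continuousAt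
  set θ : ℝ → ℝ := fun s => Θ (p s) with hθ
  set θ' : ℝ → ℝ := fun s => Θ' (p s) * (p s * (S s / n)) with hθ'
  have hθn : ∀ s, 0 ≤ θ s := fun s => hΘn _ (hp0 s)
  have hθB : ∀ s, θ s ≤ B := fun s => hΘB _ (hp0 s)
  have hcθ : Continuous θ := hcΘ.comp hcp
  have hcθ' : Continuous θ' := by fun_prop
  have hR₂d : ∀ s, HasDerivAt (fun s => R s + h * θ s) (R' s + h * θ' s) s := fun s =>
    (H.hasDerivAt s).add (((hΘ (p s)).comp s (hpd s)).const_mul h)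
  have hR₂le : ∀ s, ε ≤ R s + h * θ s := fun s =>
    (H.le s).trans (le_add_of_nonneg_right (mul_nonneg hh (hθn s)))
  have hR₂pos : ∀ s, 0 < R s + h * θ s := fun s => hε.trans_le (hR₂le s)
  have hcR₂ : Continuous fun s => R s + h * θ s := by fun_prop
  set S₂ : ℝ → ℝ := fun s => slope π s (R s + h * θ s) (R' s) with hS₂
  have hcS₂ : Continuous S₂ := continuous_slope_comp hm hcR₂ hcR' hR₂pos
  have hSa : ∀ s, |S s| ≤ a * Λ := fun s =>
    (abs_slope_le_of_le hm hε (H.le s) s _).trans (by gcongr; exact hΛ s)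
  have hS₂a : ∀ s, |S₂ s| ≤ a * Λ := fun s =>
    (abs_slope_le_of_le hm hε (hR₂le s) s _).trans (by gcongr; exact hΛ s)
  have hθ'B : ∀ s, |θ' s| ≤ B * a * Λ := fun s => by
    have e : θ' s = (Θ' (p s) * p s) * (S s / n) := by simp only [hθ']; ring
    have h1 : |S s / n| ≤ a * Λ := by
      rw [abs_div, Nat.abs_cast]
      exact (div_le_self (abs_nonneg _) hn1).trans (hSa s)
    rw [e, abs_mul, mul_assoc]
    exact mul_le_mul (hΘ'B _ (hp0 s)) h1 (abs_nonneg _) hB0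
  set Ψ₂ : ℝ → ℝ := fun s => Ψ s - h * θ s / n * S₂ s ^ 2 + h * θ' s * S₂ s
    + (h * θ' s) ^ 2 / 4 * (n / ε) with hΨ₂
  have hcΨ := H.continuous_energy
  refine ⟨fun s => R s + h * θ s, fun s => R' s + h * θ' s, Ψ₂, ⟨hR₂d, by fun_prop, hR₂le, ?_, ?_,
    by fun_prop, fun s hs => ?_⟩, fun s => ⟨?_, ?_⟩, fun s => ?_, fun ω hω => ?_⟩
  · simp only [hθ, hp, H.left]
    rw [← hp₀, hΘ0, mul_one]
  · simp only [hθ, hp, H.right]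
    rw [← hp₁, hΘ1, mul_one]
  · refine (EnergyLe.add_rate hm (hR₂pos s) ((H.energyLe s hs).heat hm hn (hpos s)
      (mul_nonneg hh (hθn s))) (h * θ' s)).mono ?_
    have h1 := fisher_le hm (hR₂pos s) s
    have h2 : (n : ℝ) / (R s + h * θ s) ≤ n / ε := by gcongr; exact hR₂le s
    simp only [hΨ₂, hS₂]
    gcongr
    exact h1.trans h2
  · exact le_add_of_nonneg_right (mul_nonneg hh (hθn s))
  · have := mul_le_mul_of_nonneg_left (hθB s) hh
    simp only
    linarith
  · have h1 : |R' s + h * θ' s| ≤ |R' s| + h * (B * a * Λ) := by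
      refine (abs_add_le _ _).trans ?_
      rw [abs_mul, abs_of_nonneg hh]
      gcongr
      exact hθ'B s
    have := hΛ s
    simp only
    linarith
  · have hpt : ∀ s ∈ Icc (0 : ℝ) 1, Ψ₂ s ≤ Ψ s + (-h) * (p s ^ 2 * φ' (p s) * S s ^ 2 / n /
        (p₀ * p₁)) + h * (3 * (B * a * Λ) * ω + h * ((B * a * Λ) ^ 2 / 4 * (n / ε))) := by
      intro s hs
      have e1 : -(p s ^ 2 * φ' (p s) * S s ^ 2 / n / (p₀ * p₁)) = θ' s * S s - θ s / n * S s ^ 2 := by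
        have := hid (p s)
        have e : p s ^ 2 * φ' (p s) = -(p₀ * p₁ * (Θ' (p s) * p s - Θ (p s))) := by linarith
        have e' : -(-(p₀ * p₁ * (Θ' (p s) * p s - Θ (p s))) * S s ^ 2 / n / (p₀ * p₁))
            = (Θ' (p s) * p s - Θ (p s)) * S s ^ 2 / n := by
          generalize p₀ * p₁ = P at hpp
          field_simp
        rw [e, e']
        simp only [hθ', hθ]
        ring
      have e2 : (θ' s * S₂ s - θ s / n * S₂ s ^ 2) - (θ' s * S s - θ s / n * S s ^ 2)
          = (S₂ s - S s) * (θ' s - θ s / n * (S₂ s + S s)) := by ring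
      have b1 : |θ s / n * (S₂ s + S s)| ≤ B * (a * Λ + a * Λ) := by
        rw [abs_mul]
        refine mul_le_mul ?_ ((abs_add_le _ _).trans (add_le_add (hS₂a s) (hSa s)))
          (abs_nonneg _) hB0
        rw [abs_div, Nat.abs_cast, abs_of_nonneg (hθn s)]
        exact (div_le_self (hθn s) hn1).trans (hθB s)
      have b2 : |θ' s - θ s / n * (S₂ s + S s)| ≤ 3 * (B * a * Λ) := by
        refine (abs_sub _ _).trans ?_
        have := hθ'B s
        linarith
      have b3 : (S₂ s - S s) * (θ' s - θ s / n * (S₂ s + S s)) ≤ 3 * (B * a * Λ) * ω := by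
        refine (le_abs_self _).trans ?_
        rw [abs_mul, mul_comm]
        exact mul_le_mul b2 (hω s hs) (abs_nonneg _) (by positivity)
      have b4 : θ' s ^ 2 ≤ (B * a * Λ) ^ 2 := sq_le_sq' (abs_le.1 (hθ'B s)).1 (abs_le.1 (hθ'B s)).2
      have b5 : h * (θ' s * S₂ s - θ s / n * S₂ s ^ 2) ≤ h * (θ' s * S s - θ s / n * S s ^ 2
          + 3 * (B * a * Λ) * ω) := by gcongr; linarith
      have b6 : (h * θ' s) ^ 2 / 4 * (n / ε) ≤ h * (h * ((B * a * Λ) ^ 2 / 4 * (n / ε))) := by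
        have : (h * θ' s) ^ 2 / 4 * (n / ε) = h * (h * (θ' s ^ 2 / 4 * (n / ε))) := by ring
        rw [this]
        gcongr
      rw [neg_mul, ← mul_neg, e1]
      simp only [hΨ₂]
      have e3 : h * θ s / n * S₂ s ^ 2 = h * (θ s / n * S₂ s ^ 2) := by ring
      rw [e3]
      linarith
    have hcI : Continuous fun s => p s ^ 2 * φ' (p s) * S s ^ 2 / n / (p₀ * p₁) := by fun_prop
    have i1 : IntervalIntegrable Ψ volume 0 1 := hcΨ.intervalIntegrable _ _
    have i2 : IntervalIntegrable (fun s => (-h) * (p s ^ 2 * φ' (p s) * S s ^ 2 / n /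
      (p₀ * p₁))) volume 0 1 := (hcI.const_mul _).intervalIntegrable _ _
    refine (intervalIntegral.integral_mono_on zero_le_one
      ((by fun_prop : Continuous Ψ₂).intervalIntegrable _ _) ((i1.add i2).add (by simp))
      hpt).trans ?_
    rw [intervalIntegral.integral_add (i1.add i2) (by simp), intervalIntegral.integral_add i1 i2,
      intervalIntegral.integral_const_mul, intervalIntegral.integral_const]
    have := mul_le_mul_of_nonneg_left hint hh
    simp only [sub_zero, one_smul]
    linarith

end

section

variable {n : ℕ} {π : Measure (Eucl n × Eucl n)} [IsProbabilityMeasure π]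

lemma continuousOn_ent (hm : SecondMoments π) (s : ℝ) : ContinuousOn (ent π s) (Ioi 0) := by
  intro t ht
  have h := continuousAt_ent hm (mem_Ioi.1 ht) s
  have h' : ContinuousAt (fun t : ℝ => ((s, t) : ℝ × ℝ)) t := by fun_prop
  exact (ContinuousAt.comp (f := fun t : ℝ => ((s, t) : ℝ × ℝ)) h h').continuousWithinAt

lemma continuousOn_dissip (hm : SecondMoments π) : ContinuousOn (dissip π) (Ioi 0) := by
  have h0 := continuousOn_ent hm 0
  have h1 := continuousOn_ent hm 1
  unfold dissip
  exact continuousOn_const.mul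
    ((Real.continuous_sinh.comp_continuousOn ((h0.sub h1).div_const _)).pow 2)

lemma exists_exp_ent_mem (hm : SecondMoments π) {ε τ : ℝ} (hε : 0 < ε) :
    ∃ l u : ℝ, 0 < l ∧ ∀ t ∈ Icc ε τ, Real.exp (ent π 0 t / n) ∈ Icc l u ∧
      Real.exp (ent π 1 t / n) ∈ Icc l u := by
  have hsub : Icc ε τ ⊆ Ioi 0 := fun t ht => hε.trans_le ht.1
  obtain ⟨M₀, h₀⟩ := isCompact_Icc.exists_bound_of_continuousOn ((continuousOn_ent hm 0).mono hsub)
  obtain ⟨M₁, h₁⟩ := isCompact_Icc.exists_bound_of_continuousOn ((continuousOn_ent hm 1).mono hsub)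
  refine ⟨Real.exp (-max M₀ M₁ / n), Real.exp (max M₀ M₁ / n), Real.exp_pos _, fun t ht => ?_⟩
  have a₀ := abs_le.1 ((h₀ t ht).trans (le_max_left M₀ M₁))
  have a₁ := abs_le.1 ((h₁ t ht).trans (le_max_right M₀ M₁))
  refine ⟨⟨?_, ?_⟩, ?_, ?_⟩ <;> gcongr
  exacts [a₀.1, a₀.2, a₁.1, a₁.2]

lemma exists_slope_modulus (hm : SecondMoments π) {ε M Λ ω : ℝ} (hε : 0 < ε) (hω : 0 < ω) :
    ∃ δ > 0, ∀ s ∈ Icc (0 : ℝ) 1, ∀ r ∈ Icc ε M, ∀ r' ∈ Icc ε M, ∀ c, |c| ≤ Λ → |r' - r| < δ →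
      |slope π s r' c - slope π s r c| ≤ ω := by
  have hK : IsCompact (Icc (0 : ℝ) 1 ×ˢ Icc ε M ×ˢ Icc (-Λ) Λ) :=
    isCompact_Icc.prod (isCompact_Icc.prod isCompact_Icc)
  have hc : ContinuousOn (fun q : ℝ × ℝ × ℝ => slope π q.1 q.2.1 q.2.2)
      (Icc (0 : ℝ) 1 ×ˢ Icc ε M ×ˢ Icc (-Λ) Λ) := fun q hq =>
    (continuousAt_slope hm (hε.trans_le hq.2.1.1) q.1 q.2.2).continuousWithinAt
  obtain ⟨δ, hδ, h⟩ := Metric.uniformContinuousOn_iff.1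
    (hK.uniformContinuousOn_of_continuous hc) ω hω
  refine ⟨δ, hδ, fun s hs r hr r' hr' c hc hd => ?_⟩
  have := h (s, r', c) ⟨hs, hr', abs_le.1 hc⟩ (s, r, c) ⟨hs, hr, abs_le.1 hc⟩
    (by simpa [Prod.dist_eq, Real.dist_eq, hδ] using hd)
  exact this.le

lemma hasDerivAt_integral_dissip (hm : SecondMoments π) {ε s : ℝ} (hε : 0 < ε) (hs : 0 < s) :
    HasDerivAt (fun t => ∫ x in ε..t, dissip π x) (dissip π s) s := by
  have hc := continuousOn_dissip hm
  refine intervalIntegral.integral_hasDerivAt_right ?_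
    (hc.stronglyMeasurableAtFilter isOpen_Ioi s hs) (hc.continuousAt (Ioi_mem_nhds hs))
  refine (hc.mono fun x hx => ?_).intervalIntegrable
  exact (lt_min hε hs).trans_le hx.1

theorem couplingLe_heat (hm : SecondMoments π) (hn : 1 ≤ n) {ε τ η : ℝ} (hε : 0 < ε) (hετ : ε < τ)
    (hη : 0 < η) :
    CouplingLe ((PG π).map (pt 1 τ)) ((PG π).map (pt 0 τ))
      (velSq π - (∫ t in ε..τ, dissip π t) + η) := by
  obtain ⟨l, u, hl, hlu⟩ := exists_exp_ent_mem hm (τ := τ) hε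
  set T := τ - ε with hT
  have hT0 : 0 < T := sub_pos.2 hετ
  set B := 2 * (u / l) ^ 2 with hB
  have hB0 : 0 ≤ B := by positivity
  set b := B * (velSq π + n / ε) with hb
  have hb0 : 0 ≤ b := mul_nonneg hB0 (add_nonneg (velSq_nonneg π) (by positivity))
  set Λ := Real.exp (T * b) with hΛ
  set A := 3 * (b * Λ) with hA
  have hA0 : 0 ≤ A := by positivity
  set C := (b * Λ) ^ 2 / 4 * (n / ε) with hC
  set ξ := η / (2 * T * (A + 2)) with hξ
  have hξ0 : 0 < ξ := by positivity
  obtain ⟨δ, hδ, hmod⟩ := exists_slope_modulus hm (M := ε + T * B) (Λ := Λ) hε hξ0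
  set G : ℝ → ℝ := fun t => ∫ x in ε..t, dissip π x with hG
  obtain ⟨δ', hδ', htay⟩ := exists_taylor_bound (q := G) (q' := dissip π) (a := ε) (b := τ) hξ0
    (fun s hs => hasDerivAt_integral_dissip hm hε (hε.trans_le hs.1))
    ((continuousOn_dissip hm).mono fun t ht => hε.trans_le ht.1)
  obtain ⟨N, hN0, hN1, hN2, hN3⟩ : ∃ N : ℕ, 0 < N ∧ T / N * B < δ ∧ T / N < δ' ∧ T / N * C < ξ := by
    have h0 := tendsto_const_div_atTop_nhds_zero_nat T
    have h1 := h0.mul_const B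
    have h2 := h0.mul_const C
    rw [zero_mul] at h1 h2
    exact ((eventually_gt_atTop 0).and ((h1.eventually_lt_const hδ).and
      ((h0.eventually_lt_const hδ').and (h2.eventually_lt_const hξ0)))).exists
  have hNpos : (0 : ℝ) < N := by exact_mod_cast hN0
  set h := T / N with hh
  have hh0 : 0 < h := by positivity
  have hNh : N * h = T := by rw [hh]; field_simp
  have key : ∀ j : ℕ, j ≤ N → ∃ R R' Ψ : ℝ → ℝ, IsProfile π ε (ε + j * h) R R' Ψ ∧
      (∀ s, R s ≤ ε + j * h * B) ∧ (∀ s, 1 + |R' s| ≤ (1 + h * b) ^ j) ∧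
      ∫ s in (0 : ℝ)..1, Ψ s ≤ velSq π - G (ε + j * h) + j * h * ((A + 2) * ξ) := by
    intro j
    induction j with
    | zero =>
      intro _
      refine ⟨fun _ => ε, fun _ => 0, fun _ => velSq π, ?_, ?_, ?_, ?_⟩
      · simpa using isProfile_const hm ε
      · simp
      · simp
      · simp [hG]
    | succ j ih =>
      intro hj
      obtain ⟨R, R', Ψ, H, hR, hR', hΨ⟩ := ih (by omega)
      have hjN : (j : ℝ) + 1 ≤ N := by exact_mod_cast hj
      have hjh : (j + 1) * h ≤ T := by rw [← hNh]; gcongr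
      have hjh0 : 0 ≤ j * h := by positivity
      have hmem : ε + j * h ∈ Icc ε τ := ⟨by linarith, by linarith⟩
      have hmem' : ε + j * h + h ∈ Icc ε τ := ⟨by linarith, by linarith⟩
      have hpow : (1 + h * b) ^ j ≤ Λ := by
        calc (1 + h * b) ^ j ≤ Real.exp (h * b) ^ j := by
              gcongr; linarith [Real.add_one_le_exp (h * b)]
          _ = Real.exp (j * h * b) := by rw [← Real.exp_nat_mul]; congr 1; ring
          _ ≤ Λ := by rw [hΛ]; gcongr; linarith
      obtain ⟨hp0, hp1⟩ := hlu _ hmem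
      obtain ⟨R₂, R₂', Ψ₂, H₂, hR₂, hR₂', hΨ₂⟩ := H.step hm hn hε hl hp0 hp1 hh0.le hR'
      rw [← hB] at hR₂ hR₂' hΨ₂
      rw [← hb] at hR₂' hΨ₂
      have hjB : j * h * B + h * B ≤ T * B := by
        calc j * h * B + h * B = (j + 1) * h * B := by ring
          _ ≤ T * B := by gcongr
      have hbd := hΨ₂ ξ fun s hs => by
        refine hmod s hs _ ⟨H.le s, ?_⟩ _ ⟨H₂.le s, ?_⟩ _ ?_ ?_
        · have := hR s
          have := mul_nonneg hh0.le hB0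
          linarith
        · linarith [hR s, (hR₂ s).2]
        · linarith [hR' s]
        · rw [abs_of_nonneg (by linarith [(hR₂ s).1])]
          linarith [(hR₂ s).2]
      have ht := (abs_le.1 (htay _ hmem _ hmem' (by linarith) (by linarith))).2
      rw [add_sub_cancel_left] at ht
      have e1 : ε + ((j + 1 : ℕ) : ℝ) * h = ε + j * h + h := by push_cast; ring
      refine ⟨R₂, R₂', Ψ₂, ?_, fun s => ?_, fun s => ?_, ?_⟩
      · rwa [e1]
      · push_cast
        linarith [hR s, (hR₂ s).2]
      · rw [pow_succ']
        exact hR₂' s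
      · have c1 : 3 * (b * (1 + h * b) ^ j) * ξ ≤ A * ξ := by rw [hA]; gcongr
        have c2 : h * ((b * (1 + h * b) ^ j) ^ 2 / 4 * (n / ε)) ≤ ξ := by
          refine le_trans ?_ hN3.le
          rw [hC]; gcongr
        have c3 := mul_le_mul_of_nonneg_left (add_le_add c1 c2) hh0.le
        rw [e1]
        push_cast
        linarith
  obtain ⟨R, R', Ψ, H, -, -, hΨ⟩ := key N le_rfl
  have hend : ε + N * h = τ := by rw [hNh]; ring
  rw [hend] at H hΨ
  rw [hNh] at hΨ
  have hc := couplingLe_of_energyLe hm H.hasDerivAt H.continuous_deriv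
    (fun s => hε.trans_le (H.le s)) H.continuous_energy H.energyLe (η := η / 6) (by positivity)
  rw [H.left, H.right] at hc
  refine hc.mono ?_
  have e2 : T * ((A + 2) * ξ) = η / 2 := by
    rw [hξ]; field_simp
  rw [e2] at hΨ
  linarith

end

section

variable {n : ℕ}

lemma continuous_gaussKer_const_sub (t : ℝ) (x : Eucl n) :
    Continuous fun y => gaussKer n t (x - y) :=
  (continuous_gaussKer t).comp (continuous_const.sub continuous_id)

lemma heat_eq_integral_gaussKer {t : ℝ} (ht : t ≠ 0) (f : Eucl n → ℝ) (x : Eucl n) :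
    heat n t f x = ∫ y, f y * gaussKer n t (x - y) := by
  simp only [heat, if_neg ht, gaussKer, mul_div_assoc]

lemma measurable_heat {t : ℝ} (ht : t ≠ 0) {f : Eucl n → ℝ} (hf : Measurable f) :
    Measurable (heat n t f) := by
  have h : StronglyMeasurable fun q : Eucl n × Eucl n => f q.2 * gaussKer n t (q.1 - q.2) :=
    ((hf.comp measurable_snd).mul ((continuous_gaussKer t).measurable.comp
      (measurable_fst.sub measurable_snd))).stronglyMeasurable
  have := (h.integral_prod_right' (ν := volume)).measurable
  exact (funext fun x => heat_eq_integral_gaussKer ht f x) ▸ this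

lemma integrable_mul_gaussKer {t : ℝ} (ht : 0 < t) {f : Eucl n → ℝ} (hf : Integrable f)
    (x : Eucl n) : Integrable fun y => f y * gaussKer n t (x - y) :=
  hf.mul_bdd (c := 1 / (2 * Real.pi * t) ^ ((n : ℝ) / 2))
    (continuous_gaussKer_const_sub t x).aestronglyMeasurable
    (ae_of_all _ fun y => by
      rw [Real.norm_of_nonneg (gaussKer_pos ht _).le]; exact gaussKer_le ht _)

lemma heat_pos {t : ℝ} (ht : 0 < t) {f : Eucl n → ℝ} (hf : Integrable f) (hpos : ∀ x, 0 < f x)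
    (x : Eucl n) : 0 < heat n t f x := by
  have hp : ∀ y, 0 < f y * gaussKer n t (x - y) := fun y => mul_pos (hpos y) (gaussKer_pos ht _)
  rw [heat_eq_integral_gaussKer ht.ne', integral_pos_iff_support_of_nonneg (fun y => (hp y).le)
    (integrable_mul_gaussKer ht hf x)]
  have : Function.support (fun y => f y * gaussKer n t (x - y)) = univ := by
    ext y; simpa using (hp y).ne'
  rw [this]
  exact Measure.measure_univ_pos.2 (NeZero.ne _)

lemma heat_le {t : ℝ} (ht : 0 < t) {f : Eucl n → ℝ} (hf : Integrable f) (hpos : ∀ x, 0 < f x)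
    (x : Eucl n) : heat n t f x ≤ (∫ y, f y) * (1 / (2 * Real.pi * t) ^ ((n : ℝ) / 2)) := by
  rw [heat_eq_integral_gaussKer ht.ne', ← integral_mul_const]
  exact integral_mono (integrable_mul_gaussKer ht hf x) (hf.mul_const _) fun y =>
    mul_le_mul_of_nonneg_left (gaussKer_le ht _) (hpos y).le

lemma aestronglyMeasurable_of_heat_ne_zero {t : ℝ} (ht : 0 < t) {f : Eucl n → ℝ}
    (h : densMeas n (heat n t f) ≠ 0) : AEStronglyMeasurable f := by
  by_contra hf
  refine h ?_
  have h0 : heat n t f = 0 := by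
    funext x
    rw [heat_eq_integral_gaussKer ht.ne']
    refine integral_non_aestronglyMeasurable fun hm => hf ?_
    have hc : Continuous fun y => (gaussKer n t (x - y))⁻¹ :=
      (continuous_gaussKer_const_sub t x).inv₀ fun y => (gaussKer_pos ht _).ne'
    refine (hm.mul hc.aestronglyMeasurable).congr (ae_of_all _ fun y => ?_)
    exact mul_inv_cancel_right₀ (gaussKer_pos ht _).ne' _
  rw [h0]
  simp [densMeas]

/-- A measurable density with finite second moment. -/
structure IsNiceDensity (u : Eucl n → ℝ) : Prop where
  aemeasurable : AEMeasurable u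
  nonneg : 0 ≤ᵐ[volume] u
  memLp : MemLp (fun x : Eucl n => x) 2 (densMeas n u)

lemma densMeas_ne_zero {ρ : Eucl n → ℝ} (hρ : ∀ x, 0 < ρ x) (hm : Measurable ρ) :
    densMeas n ρ ≠ 0 := by
  intro h
  have h' := (withDensity_eq_zero_iff hm.ennreal_ofReal.aemeasurable).1 h
  have h2 : ∀ᵐ x : Eucl n, False := by
    filter_upwards [h'] with x hx
    have : ENNReal.ofReal (ρ x) = 0 := hx
    rw [ENNReal.ofReal_eq_zero] at this
    exact absurd (hρ x) (not_lt.2 this)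
  have h3 := ae_iff.1 h2
  simp at h3
  exact NeZero.ne (volume : Measure (Eucl n)) (Measure.measure_univ_eq_zero.1 (by simpa using h3))

lemma isNiceDensity_of_densMeas_eq {u ρ : Eucl n → ℝ} [IsProbabilityMeasure (densMeas n u)]
    (hu : AEStronglyMeasurable u) (hρ : ∀ x, 0 < ρ x) (hm : Measurable ρ)
    (h2 : Integrable fun x => ‖x‖ ^ 2 * ρ x) (h : densMeas n u = densMeas n ρ) :
    IsNiceDensity u := by
  refine ⟨hu.aemeasurable, ?_, ?_⟩
  · have hfin : ∫⁻ x, ENNReal.ofReal (u x) ≠ ∞ := by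
      have := measure_univ (μ := densMeas n u)
      rw [densMeas, withDensity_apply _ MeasurableSet.univ, Measure.restrict_univ] at this
      simp [this]
    have he := (withDensity_eq_iff hu.aemeasurable.ennreal_ofReal
      hm.ennreal_ofReal.aemeasurable hfin).1 h
    filter_upwards [he] with x hx
    have : 0 < ENNReal.ofReal (u x) := by rw [hx]; exact ENNReal.ofReal_pos.2 (hρ x)
    exact (ENNReal.ofReal_pos.1 this).le
  · rw [h, memLp_two_iff_lintegral (F := fun x : Eucl n => x) aestronglyMeasurable_id, densMeas,
      lintegral_withDensity_eq_lintegral_mul _ hm.ennreal_ofReal (by fun_prop)]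
    refine lt_of_le_of_lt (lintegral_mono fun x => ?_) h2.2
    simp only [Pi.mul_apply, enorm_mul, enorm_pow, enorm_norm, Real.enorm_of_nonneg (hρ x).le]
    rw [mul_comm]

lemma schwartz_mul_heat {f g : Eucl n → ℝ} (hf : IsSchwartz n f) (hg : IsSchwartz n g)
    (hf0 : ∀ x, 0 < f x) (hg0 : ∀ x, 0 < g x) :
    (∀ x, 0 < f x * heat n 1 g x) ∧ Measurable (fun x => f x * heat n 1 g x) ∧
      Integrable fun x => ‖x‖ ^ 2 * (f x * heat n 1 g x) := by
  obtain ⟨F, rfl⟩ := hf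
  obtain ⟨G, rfl⟩ := hg
  have hmh := measurable_heat (n := n) one_ne_zero G.continuous.measurable
  refine ⟨fun x => mul_pos (hf0 x) (heat_pos one_pos G.integrable hg0 x),
    F.continuous.measurable.mul hmh, ?_⟩
  have h := (F.integrable_pow_mul volume 2).mul_bdd (g := heat n 1 G) hmh.aestronglyMeasurable
    (ae_of_all _ fun x => by
      rw [Real.norm_of_nonneg (heat_pos one_pos G.integrable hg0 x).le]
      exact heat_le one_pos G.integrable hg0 x)
  refine h.congr (ae_of_all _ fun x => ?_)
  simp only [Real.norm_of_nonneg (hf0 x).le, mul_assoc]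

lemma isNiceDensity_of_PiS {u v : Eucl n → ℝ} (hu : IsProbabilityMeasure (densMeas n u))
    (hv : IsProbabilityMeasure (densMeas n v)) (hPiS : ∀ s t : ℝ, 0 ≤ s → 0 ≤ t →
      PiS n (densMeas n (heat n s u)) (densMeas n (heat n t v))) :
    IsNiceDensity u ∧ IsNiceDensity v := by
  have hz : ∀ w : Eucl n → ℝ, heat n 0 w = w := fun w => funext fun x => by simp [heat]
  obtain ⟨f₁, g₁, hf₁, hg₁, hf₁0, hg₁0, -, h₁u, h₁v⟩ := hPiS 1 1 zero_le_one zero_le_one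
  obtain ⟨f, g, hf, hg, hf0, hg0, -, hu0, hv0⟩ := hPiS 0 0 le_rfl le_rfl
  rw [hz] at hu0 hv0
  obtain ⟨a1, a2, -⟩ := schwartz_mul_heat hf₁ hg₁ hf₁0 hg₁0
  obtain ⟨b1, b2, -⟩ := schwartz_mul_heat hg₁ hf₁ hg₁0 hf₁0
  obtain ⟨c1, c2, c3⟩ := schwartz_mul_heat hf hg hf0 hg0
  obtain ⟨d1, d2, d3⟩ := schwartz_mul_heat hg hf hg0 hf0
  exact ⟨isNiceDensity_of_densMeas_eq (aestronglyMeasurable_of_heat_ne_zero one_pos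
      (h₁u ▸ densMeas_ne_zero a1 a2)) c1 c2 c3 hu0,
    isNiceDensity_of_densMeas_eq (aestronglyMeasurable_of_heat_ne_zero one_pos
      (h₁v ▸ densMeas_ne_zero b1 b2)) d1 d2 d3 hv0⟩

lemma IsNiceDensity.heat_eq {u : Eucl n → ℝ} (hu : IsNiceDensity u) {t : ℝ} (ht : t ≠ 0)
    (x : Eucl n) : heat n t u x = ∫ y, gaussKer n t (x - y) ∂(densMeas n u) := by
  rw [heat_eq_integral_gaussKer ht, densMeas, integral_withDensity_eq_integral_toReal_smul₀
    hu.aemeasurable.ennreal_ofReal (by simp)]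
  refine integral_congr_ae ?_
  filter_upwards [hu.nonneg] with y hy
  rw [ENNReal.toReal_ofReal hy, smul_eq_mul]

section Coupling

variable {π : Measure (Eucl n × Eucl n)} {u v : Eucl n → ℝ}

lemma IsNiceDensity.heat_eq_dens_zero {ν : Measure (Eucl n)} (hv : IsNiceDensity v)
    (hπ : Coupling π (densMeas n v) ν) {t : ℝ} (ht : t ≠ 0) : heat n t v = dens π 0 t := by
  funext x
  rw [hv.heat_eq ht, ← hπ.2.1, integral_map (by fun_prop)
    (continuous_gaussKer_const_sub t x).aestronglyMeasurable]
  simp [dens, line]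

lemma IsNiceDensity.heat_eq_dens_one {ν : Measure (Eucl n)} (hu : IsNiceDensity u)
    (hπ : Coupling π ν (densMeas n u)) {t : ℝ} (ht : t ≠ 0) : heat n t u = dens π 1 t := by
  funext x
  rw [hu.heat_eq ht, ← hπ.2.2, integral_map (by fun_prop)
    (continuous_gaussKer_const_sub t x).aestronglyMeasurable]
  simp [dens, line]

lemma entDens_dens [IsProbabilityMeasure π] {t : ℝ} (ht : 0 < t) (s : ℝ) :
    entDens n (dens π s t) = -ent π s t := by
  rw [ent, neg_neg, integral_comp_pt ht s (F := fun x => Real.log (dens π s t x))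
    (continuous_dens ht s).measurable.log, entDens]

end Coupling

lemma W2sq_le_of_couplingLe {μ ν : Measure (Eucl n)} {c : ℝ} (h : CouplingLe μ ν c) :
    W2sq n μ ν ≤ c := by
  obtain ⟨ρ, hρ, hm, hc⟩ := h
  rw [integral_normSq_eq_toReal hm.1] at hc
  refine le_trans ?_ hc
  exact ENNReal.toReal_mono ((memLp_two_iff_lintegral hm.1).1 hm).ne
    (iInf_le (fun π : {π : Measure (Eucl n × Eucl n) // Coupling π μ ν} =>
      ∫⁻ p, (‖p.1 - p.2‖₊ : ℝ≥0∞) ^ 2 ∂(π.1)) ⟨ρ, hρ⟩)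

lemma exists_coupling_le_W2sq {μ ν : Measure (Eucl n)} [IsProbabilityMeasure μ]
    [IsProbabilityMeasure ν] (hμ : MemLp (fun x : Eucl n => x) 2 μ)
    (hν : MemLp (fun x : Eucl n => x) 2 ν) {η : ℝ} (hη : 0 < η) :
    ∃ π, Coupling π ν μ ∧ SecondMoments π ∧ velSq π ≤ W2sq n μ ν + η := by
  have hmem : ∀ π, Coupling π μ ν →
      MemLp (fun p : Eucl n × Eucl n => p.1) 2 π ∧ MemLp (fun p : Eucl n × Eucl n => p.2) 2 π := by
    rintro π ⟨-, rfl, rfl⟩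
    exact ⟨(memLp_map_measure_iff hμ.1 (by fun_prop)).1 hμ,
      (memLp_map_measure_iff hν.1 (by fun_prop)).1 hν⟩
  have hsub : ∀ π, Coupling π μ ν → MemLp (fun p : Eucl n × Eucl n => p.1 - p.2) 2 π :=
    fun π hπ => (hmem π hπ).1.sub (hmem π hπ).2
  have hfin : ∀ π, Coupling π μ ν → ∫⁻ p, (‖p.1 - p.2‖₊ : ℝ≥0∞) ^ 2 ∂π < ∞ := fun π hπ =>
    (memLp_two_iff_lintegral (hsub π hπ).1).1 (hsub π hπ)
  have hprod : Coupling (μ.prod ν) μ ν := ⟨inferInstance, by simp, by simp⟩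
  set I := ⨅ π : {π : Measure (Eucl n × Eucl n) // Coupling π μ ν},
      ∫⁻ p, (‖p.1 - p.2‖₊ : ℝ≥0∞) ^ 2 ∂(π.1) with hI
  have hIfin : I ≠ ∞ := ((iInf_le (fun π : {π : Measure (Eucl n × Eucl n) // Coupling π μ ν} =>
      ∫⁻ p, (‖p.1 - p.2‖₊ : ℝ≥0∞) ^ 2 ∂(π.1)) ⟨_, hprod⟩).trans_lt (hfin _ hprod)).ne
  have hlt : I < I + ENNReal.ofReal η :=
    ENNReal.lt_add_right hIfin (ENNReal.ofReal_pos.2 hη).ne'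
  obtain ⟨⟨π, hπ⟩, hlt'⟩ := iInf_lt_iff.1 (hI ▸ hlt)
  have := hπ.1
  obtain ⟨m1, m2⟩ := hmem π hπ
  have hc1 : MemLp (fun p : Eucl n × Eucl n => p.1) 2 (π.map Prod.swap) :=
    (memLp_map_measure_iff (by fun_prop) (by fun_prop)).2 m2
  have hc2 : MemLp (fun p : Eucl n × Eucl n => p.2) 2 (π.map Prod.swap) :=
    (memLp_map_measure_iff (by fun_prop) (by fun_prop)).2 m1
  refine ⟨π.map Prod.swap, ⟨Measure.isProbabilityMeasure_map (by fun_prop), ?_, ?_⟩, ⟨hc1, hc2⟩, ?_⟩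
  · rw [Measure.map_map (by fun_prop) (by fun_prop)]
    exact hπ.2.2
  · rw [Measure.map_map (by fun_prop) (by fun_prop)]
    exact hπ.2.1
  · have e : velSq (π.map Prod.swap) = ∫ p, ‖p.1 - p.2‖ ^ 2 ∂π := by
      rw [velSq, integral_map (by fun_prop) (by fun_prop)]
      rfl
    rw [e, integral_normSq_eq_toReal (hsub π hπ).1, W2sq, ← hI,
      ← ENNReal.toReal_ofReal hη.le, ← ENNReal.toReal_add hIfin ENNReal.ofReal_ne_top]
    exact ENNReal.toReal_mono (by simp [hIfin]) hlt'.le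

lemma le_sub_integral_of_forall {g : ℝ → ℝ} {a b τ : ℝ} (hτ : 0 < τ) (hg : ∀ t, 0 ≤ g t)
    (h : ∀ ε ∈ Ioo 0 τ, a ≤ b - ∫ t in ε..τ, g t) : a ≤ b - ∫ t in (0 : ℝ)..τ, g t := by
  by_cases hi : IntervalIntegrable g volume 0 τ
  · have hc := intervalIntegral.continuousOn_primitive_interval' hi.symm left_mem_uIcc
    have hc0 : Tendsto (fun ε => ∫ t in τ..ε, g t) (𝓝[Ioo 0 τ] 0) (𝓝 (∫ t in τ..0, g t)) := by
      refine (hc 0 right_mem_uIcc).mono_left (nhdsWithin_mono _ ?_)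
      rw [uIcc_of_ge hτ.le]
      exact Ioo_subset_Icc_self
    have hne : (𝓝[Ioo 0 τ] (0 : ℝ)).NeBot := by
      rw [nhdsWithin_Ioo_eq_nhdsGT hτ]; infer_instance
    rw [intervalIntegral.integral_symm, sub_neg_eq_add]
    refine ge_of_tendsto (hc0.const_add b) ?_
    filter_upwards [self_mem_nhdsWithin] with ε hε
    have := h ε hε
    rw [intervalIntegral.integral_symm] at this
    linarith
  · rw [intervalIntegral.integral_undef hi, sub_zero]
    refine (h (τ / 2) ⟨by linarith, by linarith⟩).trans ?_
    have := intervalIntegral.integral_nonneg (μ := volume) (f := g) (a := τ / 2) (b := τ)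
      (by linarith) fun t _ => hg t
    linarith

end

end HeatContraction
end

/-- Dimensional contraction of the squared Wasserstein distance along the heat flow. -/
theorem wasserstein_contraction (n : ℕ) (hn : 1 ≤ n) (u v : Eucl n → ℝ)
    (hu : IsProbabilityMeasure (densMeas n u)) (hv : IsProbabilityMeasure (densMeas n v))
    (hPiS : ∀ s t : ℝ, 0 ≤ s → 0 ≤ t →
      PiS n (densMeas n (heat n s u)) (densMeas n (heat n t v))) :
    ∀ τ : ℝ, 0 < τ →
      W2sq n (densMeas n (heat n τ u)) (densMeas n (heat n τ v))
        ≤ W2sq n (densMeas n u) (densMeas n v)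
          - 4 * n * ∫ t in (0 : ℝ)..τ,
              Real.sinh ((entDens n (heat n t u) - entDens n (heat n t v)) / (2 * n)) ^ 2 := by
  intro τ hτ
  obtain ⟨hu', hv'⟩ := HeatContraction.isNiceDensity_of_PiS hu hv hPiS
  rw [← intervalIntegral.integral_const_mul]
  refine HeatContraction.le_sub_integral_of_forall hτ (fun t => by positivity) fun ε hε => ?_
  refine le_of_forall_pos_le_add fun η hη => ?_
  obtain ⟨π, hπ, hm, hc⟩ := HeatContraction.exists_coupling_le_W2sq hu'.memLp hv'.memLp
    (half_pos hη)
  have := hπ.1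
  have h := HeatContraction.W2sq_le_of_couplingLe
    (HeatContraction.couplingLe_heat hm hn hε.1 hε.2 (half_pos hη))
  rw [HeatContraction.map_pt hτ, HeatContraction.map_pt hτ, ← hu'.heat_eq_dens_one hπ hτ.ne',
    ← hv'.heat_eq_dens_zero hπ hτ.ne'] at h
  have e : ∫ t in ε..τ, HeatContraction.dissip π t = ∫ t in ε..τ, 4 * n *
      Real.sinh ((entDens n (heat n t u) - entDens n (heat n t v)) / (2 * n)) ^ 2 := by
    refine intervalIntegral.integral_congr fun t ht => ?_
    rw [uIcc_of_le hε.2.le] at ht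
    have ht0 : 0 < t := hε.1.trans_le ht.1
    simp only [HeatContraction.dissip]
    rw [hu'.heat_eq_dens_one hπ ht0.ne', hv'.heat_eq_dens_zero hπ ht0.ne',
      HeatContraction.entDens_dens ht0, HeatContraction.entDens_dens ht0]
    congr 4
    ring
  rw [e] at h
  linarith
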